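/- arXiv:math/0101147 — 4 statements merged into one kernel-verified Lean document; each statement's English description precedes it below -/
import Mathlib

section
/- For all integers n ≥ 2 and 1 ≤ k ≤ n−1, the number of doubly rooted trees (T, r, t) on the vertex set {1, …, n} whose root component has exactly k vertices equals C(n, k) · k^{k−1} · (n−k)^{n−k}. -/
namespace ParentMap

variable {V : Type*} {f : V → Option V} {t r : V}

/-- `x` is sent to its parent `y` by the partial map `f`. -/
def Parent (f : V → Option V) (x y : V) : Prop := f x = some y

/-- A parent map is a rooted forest when following parents always terminates. -/
def IsForest (f : V → Option V) : Prop := WellFounded (flip (Parent f))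

/-- A rooted tree with root `t`, presented by its parent map. -/
structure IsRootedTree (f : V → Option V) (t : V) : Prop where
  isForest : IsForest f
  eq_none_iff : ∀ x, f x = none ↔ x = t

/-- The graph joining every vertex to its parent. -/
def graph (f : V → Option V) : SimpleGraph V := SimpleGraph.fromRel (Parent f)

theorem IsForest.exists_height (hf : IsForest f) :
    ∃ h : V → ℕ, (∀ x, f x = none → h x = 0) ∧ ∀ x y, f x = some y → h x = h y + 1 := by
  let F : ∀ x, (∀ y, flip (Parent f) y x → ℕ) → ℕ := fun x ih =>
    match hx : f x with
    | none => 0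
    | some y => ih y hx + 1
  refine ⟨hf.fix F, fun x hx => ?_, fun x y hx => ?_⟩
  · rw [hf.fix_eq]
    simp only [F]
    split <;> simp_all
  · rw [hf.fix_eq]
    simp only [F]
    split
    · simp_all
    · next z hz =>
      obtain rfl : z = y := by simpa [hx] using hz.symm
      rfl

theorem isForest_of_height (h : V → ℕ) (hh : ∀ x y, f x = some y → h y < h x) : IsForest f :=
  Subrelation.wf (fun {a b} hab => hh b a hab) (measure h).wf

theorem IsForest.ne (hf : IsForest f) {x y : V} (h : f x = some y) : x ≠ y := by
  rintro rfl
  exact hf.irrefl.irrefl x h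

theorem IsForest.graph_adj (hf : IsForest f) {x y : V} :
    (graph f).Adj x y ↔ f x = some y ∨ f y = some x := by
  simp only [graph, SimpleGraph.fromRel_adj, Parent, and_iff_right_iff_imp]
  rintro (h | h)
  · exact hf.ne h
  · exact (hf.ne h).symm

theorem height_le_height_add_length (hf : IsForest f) {h : V → ℕ}
    (hs : ∀ x y, f x = some y → h x = h y + 1) {x y : V} (p : (graph f).Walk x y) :
    h x ≤ h y + p.length := by
  induction p with
  | nil => simp
  | cons hadj p ih =>
    rw [SimpleGraph.Walk.length_cons]
    rcases hf.graph_adj.1 hadj with e | e <;> have := hs _ _ e <;> omega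

theorem exists_walk_of_reflTransGen (hf : IsForest f) {h : V → ℕ}
    (hs : ∀ x y, f x = some y → h x = h y + 1) {x y : V}
    (hxy : Relation.ReflTransGen (Parent f) x y) :
    ∃ p : (graph f).Walk x y, h x = h y + p.length := by
  induction hxy using Relation.ReflTransGen.head_induction_on with
  | refl => exact ⟨.nil, by simp⟩
  | head hab _ ih =>
    obtain ⟨p, hp⟩ := ih
    refine ⟨.cons (hf.graph_adj.2 (.inl hab)) p, ?_⟩
    rw [SimpleGraph.Walk.length_cons, hs _ _ hab, hp]
    ring

theorem reflTransGen_of_walk (hf : IsForest f) {h : V → ℕ}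
    (hs : ∀ x y, f x = some y → h x = h y + 1) {x y : V} (p : (graph f).Walk x y)
    (hp : h x = h y + p.length) : Relation.ReflTransGen (Parent f) x y := by
  induction p with
  | nil => exact .refl
  | cons hadj p ih =>
    rw [SimpleGraph.Walk.length_cons] at hp
    have hle := height_le_height_add_length hf hs p
    rcases hf.graph_adj.1 hadj with e | e
    · have := hs _ _ e
      exact .head e (ih (by omega))
    · have := hs _ _ e
      omega

namespace IsRootedTree

theorem reflTransGen_root (hf : IsRootedTree f t) (x : V) :
    Relation.ReflTransGen (Parent f) x t := by
  induction x using hf.isForest.induction with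
  | _ x ih =>
    cases hx : f x with
    | none => rw [(hf.eq_none_iff x).1 hx]
    | some y => exact .head hx (ih y hx)

theorem connected (hf : IsRootedTree f t) : (graph f).Connected := by
  obtain ⟨h, -, hs⟩ := hf.isForest.exists_height
  rw [SimpleGraph.connected_iff_exists_forall_reachable]
  exact ⟨t, fun x =>
    (exists_walk_of_reflTransGen hf.isForest hs (hf.reflTransGen_root x)).choose.reachable.symm⟩

theorem isTree [Finite V] (hf : IsRootedTree f t) : (graph f).IsTree := by
  rw [SimpleGraph.isTree_iff_connected_and_card]
  refine ⟨hf.connected, le_antisymm ?_ hf.connected.card_vert_le_card_edgeSet_add_one⟩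
  have hsub : (graph f).edgeSet ⊆ (fun x => s(x, (f x).getD t)) '' {t}ᶜ := by
    intro e
    induction e with
    | _ x y =>
      rw [SimpleGraph.mem_edgeSet, hf.isForest.graph_adj]
      rintro (h | h)
      · refine ⟨x, fun hx => ?_, by simp [h]⟩
        simp [(hf.eq_none_iff x).2 hx] at h
      · refine ⟨y, fun hx => ?_, by simp [h, Sym2.eq_swap]⟩
        simp [(hf.eq_none_iff y).2 hx] at h
  have h1 := (Set.ncard_le_ncard hsub).trans (Set.ncard_image_le (Set.toFinite _))
  have h2 := Set.ncard_add_ncard_compl ({t} : Set V)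
  rw [Set.ncard_singleton] at h2
  rw [Nat.card_coe_set_eq]
  omega

theorem height_eq_dist (hf : IsRootedTree f t) {h : V → ℕ} (h0 : ∀ x, f x = none → h x = 0)
    (hs : ∀ x y, f x = some y → h x = h y + 1) (x : V) : h x = (graph f).dist x t := by
  have ht : h t = 0 := h0 t ((hf.eq_none_iff t).2 rfl)
  obtain ⟨p, hp⟩ := exists_walk_of_reflTransGen hf.isForest hs (hf.reflTransGen_root x)
  obtain ⟨q, hq⟩ := hf.connected.exists_walk_length_eq_dist x t
  have h1 := height_le_height_add_length hf.isForest hs q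
  have h2 := SimpleGraph.dist_le p
  omega

theorem reflTransGen_iff_dist (hf : IsRootedTree f t) (x : V) :
    Relation.ReflTransGen (Parent f) x r ↔
      (graph f).dist x t = (graph f).dist x r + (graph f).dist r t := by
  obtain ⟨h, h0, hs⟩ := hf.isForest.exists_height
  rw [← hf.height_eq_dist h0 hs, ← hf.height_eq_dist h0 hs]
  obtain ⟨q, hq⟩ := hf.connected.exists_walk_length_eq_dist x r
  constructor
  · intro hxr
    obtain ⟨p, hp⟩ := exists_walk_of_reflTransGen hf.isForest hs hxr
    have h1 := height_le_height_add_length hf.isForest hs q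
    have h2 := SimpleGraph.dist_le p
    omega
  · intro hd
    exact reflTransGen_of_walk hf.isForest hs q (by omega)

theorem eq_some_iff (hf : IsRootedTree f t) {x y : V} :
    f x = some y ↔ (graph f).Adj x y ∧ (graph f).dist y t < (graph f).dist x t := by
  obtain ⟨h, h0, hs⟩ := hf.isForest.exists_height
  rw [← hf.height_eq_dist h0 hs, ← hf.height_eq_dist h0 hs, hf.isForest.graph_adj]
  constructor
  · intro e
    have := hs _ _ e
    exact ⟨.inl e, by omega⟩
  · rintro ⟨e | e, hlt⟩
    · exact e
    · have := hs _ _ e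
      omega

theorem eq_of_graph_eq {g : V → Option V} (hf : IsRootedTree f t) (hg : IsRootedTree g t)
    (h : graph f = graph g) : f = g := by
  funext x
  refine Option.ext fun y => ?_
  rw [hf.eq_some_iff, hg.eq_some_iff, h]

end IsRootedTree

theorem exists_isRootedTree_graph_eq [Finite V] {T : SimpleGraph V} (hT : T.IsTree) (t : V) :
    ∃ f, IsRootedTree f t ∧ graph f = T := by
  classical
  have hstep : ∀ x, x ≠ t → ∃ y, T.Adj x y ∧ T.dist y t < T.dist x t := by
    intro x hx
    obtain ⟨p, hp⟩ := hT.connected.exists_walk_length_eq_dist x t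
    cases p with
    | nil => exact absurd rfl hx
    | cons hadj q =>
      refine ⟨_, hadj, ?_⟩
      rw [SimpleGraph.Walk.length_cons] at hp
      have := SimpleGraph.dist_le q
      omega
  choose! s hadj hdist using hstep
  let f : V → Option V := fun x => if x = t then none else some (s x)
  have hsome : ∀ x y, f x = some y → x ≠ t ∧ s x = y := fun x y h => by
    by_cases hx : x = t <;> simp_all [f]
  have hf : IsRootedTree f t := by
    refine ⟨isForest_of_height (fun x => T.dist x t) fun x y h => ?_, fun x => by simp [f]⟩
    obtain ⟨hx, rfl⟩ := hsome x y h
    exact hdist x hx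
  have hle : graph f ≤ T := by
    intro x y h
    rcases hf.isForest.graph_adj.1 h with h | h
    · obtain ⟨hx, rfl⟩ := hsome _ _ h
      exact hadj x hx
    · obtain ⟨hx, rfl⟩ := hsome _ _ h
      exact (hadj y hx).symm
  exact ⟨f, hf, le_antisymm hle
    ((SimpleGraph.isTree_iff_minimal_connected.1 hT).2 hf.connected hle)⟩

theorem acc_of_eq_none {x : V} (hx : f x = none) : Acc (flip (Parent f)) x :=
  ⟨x, fun y hy => by simp [flip, Parent, hx] at hy⟩

theorem IsForest.acc_of_eqOn {g : V → Option V} (hg : IsForest g) (s : Set V)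
    (h : ∀ x ∈ s, Acc (flip (Parent f)) x ∨ f x = g x ∧ ∀ y, f x = some y → y ∈ s) :
    ∀ x ∈ s, Acc (flip (Parent f)) x := by
  intro x
  induction x using hg.induction with
  | _ x ih =>
    intro hx
    rcases h x hx with hacc | ⟨hfg, hs⟩
    · exact hacc
    · exact ⟨x, fun y hy => ih y (hfg.symm.trans hy) (hs y hy)⟩

/-- A parent map that only uses edges of a forest is a forest. -/
theorem IsForest.mono {g : V → Option V} (hg : IsForest g)
    (h : ∀ x y, f x = some y → g x = some y) : IsForest f :=
  Subrelation.wf (fun {_ _} hab => h _ _ hab) hg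

theorem IsForest.not_reflTransGen (hf : IsForest f) {p : V} (hp : f r = some p) :
    ¬ Relation.ReflTransGen (Parent f) p r := fun h =>
  hf.transGen.irrefl.irrefl r (Relation.transGen_swap.1 (Relation.TransGen.head' hp h))

section Count

open Finset

variable [Fintype V] [DecidableEq V]

open Classical in
/-- The parent maps of the rooted forests on `D ∪ A` with set of roots `A`, where `D` and `A` are
disjoint; they have no value outside `D`. -/
noncomputable def forests (D A : Finset V) : Finset (V → Option V) :=
  {f | IsForest f ∧ (∀ x, f x = none ↔ x ∉ D) ∧ ∀ x y, f x = some y → y ∈ D ∪ A}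

theorem mem_forests {D A : Finset V} : f ∈ forests D A ↔
    IsForest f ∧ (∀ x, f x = none ↔ x ∉ D) ∧ ∀ x y, f x = some y → y ∈ D ∪ A := by
  simp [forests]

/-- The partial maps with domain `B` and values in `A`. -/
def partialMaps (B A : Finset V) : Finset (V → Option V) :=
  Fintype.piFinset fun x => if x ∈ B then A.map .some else {none}

theorem mem_partialMaps {B A : Finset V} : f ∈ partialMaps B A ↔
    (∀ x ∈ B, ∃ y ∈ A, f x = some y) ∧ ∀ x ∉ B, f x = none := by
  rw [partialMaps, Fintype.mem_piFinset, ← forall_and]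
  refine forall_congr' fun x => ?_
  by_cases hx : x ∈ B <;> simp [hx, eq_comm]

theorem card_partialMaps (B A : Finset V) : #(partialMaps B A) = #A ^ #B := by
  have h : ∀ x, #(if x ∈ B then A.map .some else {none}) = if x ∈ B then #A else 1 := by
    intro x
    split <;> simp
  simp [partialMaps, Fintype.card_piFinset, h, prod_ite_mem]

theorem forests_empty_left (A : Finset V) : forests ∅ A = {fun _ => none} := by
  ext f
  simp only [mem_forests, notMem_empty, not_false_eq_true, iff_true, mem_singleton, funext_iff]
  constructor
  · exact fun h => h.2.1
  · exact fun h => ⟨isForest_of_height 0 (by simp [h]), h, by simp [h]⟩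

theorem forests_empty_right {D : Finset V} (hD : D.Nonempty) : forests D ∅ = ∅ := by
  refine eq_empty_of_forall_notMem fun f hf => ?_
  obtain ⟨hw, hn, hs⟩ := mem_forests.1 hf
  obtain ⟨x, hx, hmin⟩ := hw.has_min D hD
  obtain ⟨y, hy⟩ := Option.ne_none_iff_exists'.1 (fun h => (hn x).1 h hx)
  exact hmin y (by simpa using hs x y hy) hy

theorem card_forests_fiber {D A B : Finset V} (hDA : Disjoint D A) (hB : B ⊆ D) :
    #{f ∈ forests D A | {x ∈ D | ∃ y ∈ A, f x = some y} = B} =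
      #A ^ #B * #(forests (D \ B) B) := by
  rw [← card_partialMaps, ← card_product]
  refine card_nbij' (fun f => (fun x => if x ∈ B then f x else none,
      fun x => if x ∈ B then none else f x))
    (fun p x => if x ∈ B then p.1 x else p.2 x) ?_ ?_ ?_ ?_
  · intro f hf
    obtain ⟨hfD, hfB⟩ := mem_filter.1 (mem_coe.1 hf)
    obtain ⟨hw, hn, hs⟩ := mem_forests.1 hfD
    have hmem : ∀ x, x ∈ B ↔ x ∈ D ∧ ∃ y ∈ A, f x = some y := fun x => by
      rw [← hfB, mem_filter]
    refine mem_coe.2 (mem_product.2 ⟨mem_partialMaps.2 ⟨fun x hx => ?_, fun x hx => if_neg hx⟩,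
      mem_forests.2 ⟨hw.mono fun x y h => ?_, fun x => ?_, fun x y h => ?_⟩⟩)
    · simpa only [if_pos hx] using ((hmem x).1 hx).2
    · grind
    · grind
    · grind
  · rintro ⟨g, h⟩ hp
    obtain ⟨hg, hh⟩ := mem_product.1 (mem_coe.1 hp)
    obtain ⟨hgB, hgn⟩ := mem_partialMaps.1 hg
    obtain ⟨hw, hn, hs⟩ := mem_forests.1 hh
    have hA : ∀ x ∈ A, x ∉ D := fun x hx hxD => disjoint_left.1 hDA hxD hx
    simp only [coe_filter, Set.mem_ofPred_eq]
    refine ⟨mem_forests.2 ⟨⟨fun x => hw.acc_of_eqOn Set.univ (fun x _ => ?_) x trivial⟩,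
      fun x => ?_, fun x y h => ?_⟩, ?_⟩
    · by_cases hx : x ∈ B
      · refine .inl ⟨x, fun y hy => acc_of_eq_none ?_⟩
        simp only [flip, Parent, if_pos hx] at hy
        grind
      · exact .inr ⟨if_neg hx, fun _ _ => trivial⟩
    · grind
    · grind
    · ext x
      grind
  · intro f _
    funext x
    grind
  · rintro ⟨g, h⟩ hp
    obtain ⟨hg, hh⟩ := mem_product.1 (mem_coe.1 hp)
    obtain ⟨hgB, hgn⟩ := mem_partialMaps.1 hg
    obtain ⟨hw, hn, hs⟩ := mem_forests.1 hh
    ext x : 2 <;> grind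

theorem card_forests_eq_sum {D A : Finset V} (hDA : Disjoint D A) :
    #(forests D A) = ∑ B ∈ D.powerset, #A ^ #B * #(forests (D \ B) B) := by
  rw [card_eq_sum_card_fiberwise (f := fun f => {x ∈ D | ∃ y ∈ A, f x = some y})
    (t := D.powerset) (fun f _ => mem_coe.2 (mem_powerset.2 (filter_subset _ _)))]
  exact sum_congr rfl fun B hB => card_forests_fiber hDA (mem_powerset.1 hB)

theorem sum_choose_mul_mul_pow (d a c : ℕ) :
    ∑ b ∈ range (d + 2), (d + 1).choose b * (b * a ^ b * c ^ (d + 1 - b)) =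
      (d + 1) * a * (a + c) ^ d := by
  rw [sum_range_succ', add_pow, mul_sum]
  simp only [zero_mul, mul_zero, add_zero]
  refine sum_congr rfl fun b _ => ?_
  have := Nat.add_one_mul_choose_eq d b
  rw [Nat.add_sub_add_right]
  calc _ = (d + 1).choose (b + 1) * (b + 1) * (a * a ^ b * c ^ (d - b)) := by ring
    _ = _ := by rw [← this]; simp only [Nat.cast_id]; ring

/-- The Cayley formula for rooted forests with prescribed roots. -/
theorem card_forests {D A : Finset V} (hDA : Disjoint D A) :
    (#A + #D) * #(forests D A) = #A * (#A + #D) ^ #D := by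
  induction D using Finset.strongInduction generalizing A with
  | _ D ih =>
    rcases D.eq_empty_or_nonempty with rfl | hD
    · simp [forests_empty_left]
    obtain ⟨d, hd⟩ := Nat.exists_eq_succ_of_ne_zero hD.card_ne_zero
    have hterm : ∀ B ∈ D.powerset, #D * (#A ^ #B * #(forests (D \ B) B)) =
        #B * #A ^ #B * #D ^ (#D - #B) := by
      intro B hB
      rw [mem_powerset] at hB
      rcases B.eq_empty_or_nonempty with rfl | hB0
      · simp [forests_empty_right hD]
      have h := ih (D \ B) (sdiff_ssubset hB hB0) (A := B) sdiff_disjoint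
      rw [card_sdiff_of_subset hB, Nat.add_sub_cancel' (card_le_card hB)] at h
      rw [mul_left_comm, h]
      ring
    have hsum : #D * #(forests D A) = #D * (#A * (#A + #D) ^ d) := by
      rw [card_forests_eq_sum hDA, mul_sum, sum_congr rfl hterm,
        sum_powerset_apply_card (fun b => b * #A ^ b * #D ^ (#D - b))]
      simp only [smul_eq_mul]
      conv_lhs => rw [hd]
      rw [Nat.succ_eq_add_one, sum_choose_mul_mul_pow, mul_assoc, hd]
    rw [Nat.eq_of_mul_eq_mul_left hD.card_pos hsum, hd, Nat.succ_eq_add_one]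
    ring

end Count

theorem mem_of_reflTransGen {S : Set V} (hS : ∀ x y, f x = some y → y ∈ S → x ∈ S)
    (hr : r ∈ S) {x : V} (h : Relation.ReflTransGen (Parent f) x r) : x ∈ S := by
  induction h using Relation.ReflTransGen.head_induction_on with
  | refl => exact hr
  | head hab _ ih => exact hS _ _ hab ih

section RootComponent

open Finset

variable [Fintype V] [DecidableEq V]

open Classical in
theorem card_isRootedTree_with_component {S : Finset V} (hr : r ∈ S) (ht : t ∉ S) :
    #{f : V → Option V | IsRootedTree f t ∧
      ({x | Relation.ReflTransGen (Parent f) x r} : Finset V) = S} =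
      #Sᶜ * (#(forests (S \ {r}) {r}) * #(forests (Sᶜ \ {t}) {t})) := by
  have hrt : r ≠ t := fun h => ht (h ▸ hr)
  rw [← card_product, ← card_product]
  refine card_nbij' (fun f => ((f r).getD r, fun x => if x ∈ S \ {r} then f x else none,
      fun x => if x ∈ S then none else f x))
    (fun p x => if x = r then some p.1 else if x ∈ S then p.2.1 x else p.2.2 x) ?_ ?_ ?_ ?_
  · intro f hf
    obtain ⟨-, ⟨hw, hn⟩, hfS⟩ := mem_filter.1 (mem_coe.1 hf)
    have hmem : ∀ x, x ∈ S ↔ Relation.ReflTransGen (Parent f) x r := fun x => by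
      rw [← hfS, mem_filter_univ]
    obtain ⟨p, hp⟩ := Option.ne_none_iff_exists'.1 (fun h => hrt ((hn r).1 h))
    have hpS : p ∉ S := fun h => hw.not_reflTransGen hp ((hmem p).1 h)
    have hin : ∀ x y, f x = some y → x ≠ r → (x ∈ S ↔ y ∈ S) := by
      intro x y hxy hxr
      rw [hmem, hmem]
      refine ⟨fun h => ?_, fun h => h.head hxy⟩
      rcases h.cases_head with rfl | ⟨z, hz, hzr⟩
      · exact absurd rfl hxr
      · obtain rfl : y = z := Option.some_injective _ (hxy.symm.trans hz)
        exact hzr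
    refine mem_coe.2 (mem_product.2 ⟨by simpa [hp] using hpS, mem_product.2
      ⟨mem_forests.2 ⟨hw.mono fun x y h => ?_, fun x => ?_, fun x y h => ?_⟩,
      mem_forests.2 ⟨hw.mono fun x y h => ?_, fun x => ?_, fun x y h => ?_⟩⟩⟩)
    all_goals grind [mem_compl]
  · rintro ⟨p, g, h⟩ hp
    simp only [coe_product, Set.mem_prod, mem_coe, mem_compl, mem_forests] at hp
    obtain ⟨hpS, ⟨hgw, hgn, hgs⟩, hhw, hhn, hhs⟩ := hp
    set f : V → Option V := fun x => if x = r then some p else if x ∈ S then g x else h x with hf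
    have hout : ∀ x ∈ (S : Set V)ᶜ, Acc (flip (Parent f)) x := by
      refine hhw.acc_of_eqOn _ fun x hx => .inr ?_
      have hx' : x ∉ S := hx
      refine ⟨by grind, fun y hy => ?_⟩
      change y ∉ S
      grind [mem_compl]
    have hw : IsForest f := by
      refine ⟨fun x => hgw.acc_of_eqOn Set.univ (fun x _ => ?_) x trivial⟩
      by_cases hxS : x ∈ S
      · by_cases hxr : x = r
        · refine .inl ⟨x, fun y hy => hout y ?_⟩
          change f x = some y at hy
          change y ∉ S
          grind
        · exact .inr ⟨by grind, fun _ _ => trivial⟩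
      · exact .inl (hout x hxS)
    refine mem_coe.2 (mem_filter.2 ⟨mem_univ _, ⟨hw, fun x => by grind [mem_compl]⟩, ?_⟩)
    ext x
    rw [mem_filter_univ]
    refine ⟨mem_of_reflTransGen (S := (S : Set V)) (fun x y hxy hy => ?_) hr, fun hx => ?_⟩
    · rw [mem_coe] at hy ⊢
      grind [mem_compl]
    · induction x using hw.induction with
      | _ x ih =>
        by_cases hxr : x = r
        · rw [hxr]
        · obtain ⟨y, hy⟩ : ∃ y, g x = some y :=
            Option.ne_none_iff_exists'.1 (fun h => (hgn x).1 h (by simp [hx, hxr]))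
          have hxy : f x = some y := by grind
          exact .head hxy (ih y hxy (by grind))
  · intro f hf
    obtain ⟨-, ⟨hw, hn⟩, -⟩ := mem_filter.1 (mem_coe.1 hf)
    obtain ⟨p, hp⟩ := Option.ne_none_iff_exists'.1 (fun h => hrt ((hn r).1 h))
    funext x
    grind
  · rintro ⟨p, g, h⟩ hp
    simp only [coe_product, Set.mem_prod, mem_coe, mem_compl, mem_forests] at hp
    obtain ⟨hpS, ⟨hgw, hgn, hgs⟩, hhw, hhn, hhs⟩ := hp
    refine Prod.ext (by simp) (Prod.ext (funext fun x => ?_) (funext fun x => ?_)) <;> grind [mem_compl]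

theorem card_mul_card_forests_singleton {S : Finset V} (hr : r ∈ S) :
    #S * #(forests (S \ {r}) {r}) = #S ^ (#S - 1) := by
  have h := card_forests (D := S \ {r}) (A := {r}) sdiff_disjoint
  rw [card_sdiff_of_subset (by simpa using hr), card_singleton,
    Nat.add_sub_cancel' (card_pos.2 ⟨r, hr⟩), one_mul] at h
  exact h

open Classical in
theorem card_isRootedTree_pair_with_card_component {k : ℕ} (hk : 0 < k)
    (hkV : k < Fintype.card V) :
    #{q : (V → Option V) × V × V | IsRootedTree q.1 q.2.2 ∧ q.2.1 ≠ q.2.2 ∧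
      #{x | Relation.ReflTransGen (Parent q.1) x q.2.1} = k} =
      (Fintype.card V).choose k * k ^ (k - 1) * (Fintype.card V - k) ^ (Fintype.card V - k) := by
  rw [card_eq_sum_card_fiberwise
    (f := fun q => ({x | Relation.ReflTransGen (Parent q.1) x q.2.1} : Finset V))
    (t := powersetCard k univ) (fun q hq => by
      simpa using (mem_filter.1 (mem_coe.1 hq)).2.2.2)]
  rw [sum_congr rfl (g := fun _ => k ^ (k - 1) * (Fintype.card V - k) ^ (Fintype.card V - k)),
    sum_const, card_powersetCard, card_univ, smul_eq_mul, mul_assoc]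
  intro S hS
  have hSk : #S = k := (mem_powersetCard.1 hS).2
  have hSc : #Sᶜ = Fintype.card V - k := by rw [card_compl, hSk]
  have hcard : ∀ p ∈ S ×ˢ Sᶜ,
      #{q ∈ {q : (V → Option V) × V × V | IsRootedTree q.1 q.2.2 ∧ q.2.1 ≠ q.2.2 ∧
        #{x | Relation.ReflTransGen (Parent q.1) x q.2.1} = k} |
        ({x | Relation.ReflTransGen (Parent q.1) x q.2.1} : Finset V) = S ∧ q.2 = p} =
      #Sᶜ * (#(forests (S \ {p.1}) {p.1}) * #(forests (Sᶜ \ {p.2}) {p.2})) := by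
    rintro ⟨r, t⟩ hp
    obtain ⟨hr, ht⟩ := mem_product.1 hp
    rw [mem_compl] at ht
    rw [← card_isRootedTree_with_component hr ht]
    refine card_nbij' (fun q => q.1) (fun f => (f, r, t)) ?_ ?_ ?_ ?_
    · rintro ⟨f, r', t'⟩ hq
      simp only [coe_filter, mem_filter_univ, Set.mem_ofPred_eq, Prod.mk.injEq] at hq
      obtain ⟨⟨h1, -, -⟩, h2, rfl, rfl⟩ := hq
      exact mem_coe.2 ((mem_filter_univ _).2 ⟨h1, h2⟩)
    · intro f hf
      obtain ⟨h1, h2⟩ := (mem_filter_univ _).1 (mem_coe.1 hf)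
      refine mem_coe.2 (mem_filter.2 ⟨(mem_filter_univ _).2 ⟨h1, fun h => ht (h ▸ hr), ?_⟩, h2, rfl⟩)
      rw [← hSk, ← h2]
    · rintro ⟨f, r', t'⟩ hq
      exact Prod.ext rfl (mem_filter.1 (mem_coe.1 hq)).2.2.symm
    · exact fun _ _ => rfl
  rw [card_eq_sum_card_fiberwise (f := fun q => q.2) (t := S ×ˢ Sᶜ)]
  · simp only [filter_filter] at hcard ⊢
    rw [sum_congr rfl fun p hp => by simpa only [and_assoc] using hcard p hp]
    refine Nat.eq_of_mul_eq_mul_left (card_pos.2 (nonempty_product.2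
      ⟨card_pos.1 (hSk ▸ hk), card_pos.1 (by omega)⟩) : 0 < #(S ×ˢ Sᶜ)) ?_
    rw [mul_sum, ← smul_eq_mul, ← sum_const]
    refine sum_congr rfl fun p hp => ?_
    obtain ⟨hr, ht⟩ := mem_product.1 hp
    calc _ = #Sᶜ * (#S * #(forests (S \ {p.1}) {p.1}) *
          (#Sᶜ * #(forests (Sᶜ \ {p.2}) {p.2}))) := by rw [card_product]; ring
      _ = #S ^ (#S - 1) * (#Sᶜ * #Sᶜ ^ (#Sᶜ - 1)) := by
        rw [card_mul_card_forests_singleton hr, card_mul_card_forests_singleton ht]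
        ring
      _ = _ := by rw [mul_pow_sub_one (card_pos.2 ⟨_, ht⟩).ne', hSk, hSc]
  · rintro ⟨f, r, t⟩ hq
    obtain ⟨hq, hqS⟩ := mem_filter.1 (mem_coe.1 hq)
    obtain ⟨-, hf, hne, -⟩ := mem_filter.1 hq
    refine mem_coe.2 (mem_product.2 ⟨?_, mem_compl.2 fun h => ?_⟩)
    · rw [← hqS, mem_filter_univ]
    · rw [← hqS, mem_filter_univ] at h
      rcases h.cases_head with h | ⟨y, hy, -⟩
      · exact hne h.symm
      · exact Option.some_ne_none y (hy.symm.trans ((hf.eq_none_iff t).2 rfl))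

end RootComponent

end ParentMap

/-- For `n ≥ 2` and `1 ≤ k ≤ n - 1`, the number of doubly rooted trees `(T, r, t)`
on the vertex set `{1, …, n}` whose root component has exactly `k` vertices equals
`C(n, k) * k^(k-1) * (n-k)^(n-k)`.  The root component of `(T, r, t)` is the set of
vertices `x` with `dist T x t = dist T x r + dist T r t`. -/
theorem count_doubly_rooted_trees_by_root_component (n k : ℕ) (hn : 2 ≤ n)
    (hk1 : 1 ≤ k) (hk : k ≤ n - 1) :
    Nat.card {p : SimpleGraph (Fin n) × Fin n × Fin n //
        (p.1.Connected ∧ p.1.IsAcyclic) ∧ p.2.1 ≠ p.2.2 ∧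
        {x : Fin n |
          p.1.dist x p.2.2 = p.1.dist x p.2.1 + p.1.dist p.2.1 p.2.2}.ncard = k} =
      n.choose k * k ^ (k - 1) * (n - k) ^ (n - k) := by
  classical
  have hcount := ParentMap.card_isRootedTree_pair_with_card_component (V := Fin n) hk1
    (by rw [Fintype.card_fin]; omega)
  rw [Fintype.card_fin] at hcount
  rw [← hcount, ← Nat.card_eq_finsetCard]
  have hncard : ∀ (f : Fin n → Option (Fin n)) (r t : Fin n), ParentMap.IsRootedTree f t →
      {x | (ParentMap.graph f).dist x t =
        (ParentMap.graph f).dist x r + (ParentMap.graph f).dist r t}.ncard =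
      Finset.card {x | Relation.ReflTransGen (ParentMap.Parent f) x r} := by
    intro f r t hf
    rw [← Set.ncard_coe_finset]
    congr 1
    ext x
    simp [hf.reflTransGen_iff_dist]
  symm
  refine Nat.card_eq_of_bijective (fun q => ⟨(ParentMap.graph q.1.1, q.1.2), ?_⟩) ⟨?_, ?_⟩
  · obtain ⟨hf, hne, hk⟩ := (Finset.mem_filter_univ _).1 q.2
    exact ⟨⟨hf.isTree.connected, hf.isTree.isAcyclic⟩, hne, (hncard _ _ _ hf).trans hk⟩
  · rintro ⟨⟨f, r, t⟩, hq⟩ ⟨⟨f', r', t'⟩, hq'⟩ h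
    simp only [Subtype.mk.injEq, Prod.mk.injEq] at h
    obtain ⟨hgraph, rfl, rfl⟩ := h
    have hf := ((Finset.mem_filter_univ _).1 hq).1
    have hf' := ((Finset.mem_filter_univ _).1 hq').1
    obtain rfl := hf.eq_of_graph_eq hf' hgraph
    rfl
  · rintro ⟨⟨T, r, t⟩, ⟨hconn, hacyc⟩, hne, hcard⟩
    obtain ⟨f, hf, rfl⟩ := ParentMap.exists_isRootedTree_graph_eq ⟨hconn, hacyc⟩ t
    exact ⟨⟨(f, r, t), (Finset.mem_filter_univ _).2 ⟨hf, hne, (hncard _ _ _ hf).symm.trans hcard⟩⟩,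
      rfl⟩
end

section
/- For all real y_1, y_2 > 0: ∫_0^∞ ∫_0^∞ e^{−x_1 y_1 − x_2 y_2} · (x_1 + x_2)^{−3/2} dx_1 dx_2 = 2√π / (√y_1 + √y_2). (Equivalently, the Laplace transform of the perimeter measure with density (2π)^{−1/2}(x_1+x_2)^{−3/2} on the positive quadrant equals √2/(√y_1 + √y_2).) -/
open MeasureTheory Set Filter Topology

theorem exists_antiderivative_sq_div_mul_add_sq {a b : ℝ} (ha : 0 < a) (hb : 0 < b) :
    ∃ g : ℝ → ℝ,
      (∀ s, HasDerivAt g (s ^ 2 / ((a ^ 2 + s ^ 2) * (b ^ 2 + s ^ 2))) s) ∧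
        g 0 = 0 ∧ Tendsto g atTop (𝓝 (Real.pi / (2 * (a + b)))) := by
  have arctan_deriv {c : ℝ} (hc : 0 < c) (s : ℝ) :
      HasDerivAt (fun s => Real.arctan (s / c)) (c / (c ^ 2 + s ^ 2)) s := by
    convert ((hasDerivAt_id' s).div_const c).arctan using 1
    have : c ^ 2 + s ^ 2 ≠ 0 := by positivity
    field_simp
  have arctan_lim {c : ℝ} (hc : 0 < c) :
      Tendsto (fun s => Real.arctan (s / c)) atTop (𝓝 (Real.pi / 2)) :=
    (tendsto_nhds_of_tendsto_nhdsWithin Real.tendsto_arctan_atTop).comp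
      (tendsto_id.atTop_div_const hc)
  by_cases hab : a = b
  · subst hab
    refine ⟨fun s => (Real.arctan (s / a) / a - s / (a ^ 2 + s ^ 2)) / 2, fun s => ?_, by simp, ?_⟩
    · have h : a ^ 2 + s ^ 2 ≠ 0 := by positivity
      refine ((((arctan_deriv ha s).div_const a).sub ((hasDerivAt_id' s).div
        ((hasDerivAt_pow 2 s).const_add (a ^ 2)) h)).div_const 2).congr_deriv ?_
      field_simp
      ring
    · have h0 : Tendsto (fun s : ℝ => s / (a ^ 2 + s ^ 2)) atTop (𝓝 0) := by
        refine squeeze_zero' ?_ ?_ tendsto_inv_atTop_zero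
        · filter_upwards [eventually_gt_atTop 0] with s hs
          positivity
        · filter_upwards [eventually_gt_atTop 0] with s hs
          rw [div_le_iff₀ (by positivity), inv_mul_eq_div, le_div_iff₀ hs]
          nlinarith [sq_nonneg a]
      convert (((arctan_lim ha).div_const a).sub h0).div_const 2 using 2
      field_simp
      ring
  · have hsub : a ^ 2 - b ^ 2 ≠ 0 := by
      rw [sq_sub_sq]
      exact mul_ne_zero (by positivity) (sub_ne_zero.2 hab)
    refine ⟨fun s => (a * Real.arctan (s / a) - b * Real.arctan (s / b)) / (a ^ 2 - b ^ 2),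
      fun s => ?_, by simp, ?_⟩
    · have h1 : a ^ 2 + s ^ 2 ≠ 0 := by positivity
      have h2 : b ^ 2 + s ^ 2 ≠ 0 := by positivity
      refine ((((arctan_deriv ha s).const_mul a).sub
        ((arctan_deriv hb s).const_mul b)).div_const (a ^ 2 - b ^ 2)).congr_deriv ?_
      field_simp
      ring
    · convert (((arctan_lim ha).const_mul a).sub
        ((arctan_lim hb).const_mul b)).div_const (a ^ 2 - b ^ 2) using 2
      field_simp
      ring

theorem lintegral_sq_div_mul_add_sq {a b : ℝ} (ha : 0 < a) (hb : 0 < b) :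
    ∫⁻ s in Ioi (0 : ℝ), ENNReal.ofReal (s ^ 2 / ((a ^ 2 + s ^ 2) * (b ^ 2 + s ^ 2))) =
      ENNReal.ofReal (Real.pi / (2 * (a + b))) := by
  obtain ⟨g, hg, hg0, hlim⟩ := exists_antiderivative_sq_div_mul_add_sq ha hb
  have hpos : ∀ s ∈ Ioi (0 : ℝ), 0 ≤ s ^ 2 / ((a ^ 2 + s ^ 2) * (b ^ 2 + s ^ 2)) :=
    fun s _ => by positivity
  rw [← ofReal_integral_eq_lintegral_ofReal
    (integrableOn_Ioi_deriv_of_nonneg' (fun s _ => hg s) hpos hlim)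
    (ae_of_all _ fun s => by positivity),
    integral_Ioi_of_hasDerivAt_of_nonneg' (fun s _ => hg s) hpos hlim, hg0, sub_zero]

theorem lintegral_exp_neg_mul_Ioi_zero {c : ℝ} (hc : 0 < c) :
    ∫⁻ x in Ioi (0 : ℝ), ENNReal.ofReal (Real.exp (-c * x)) = ENNReal.ofReal c⁻¹ := by
  rw [← ofReal_integral_eq_lintegral_ofReal (integrableOn_exp_mul_Ioi (neg_lt_zero.2 hc) 0)
    (ae_of_all _ fun x => (Real.exp_pos _).le), integral_exp_mul_Ioi (neg_lt_zero.2 hc)]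
  simp

theorem lintegral_sq_mul_exp_neg_mul_sq {x : ℝ} (hx : 0 < x) :
    ∫⁻ s in Ioi (0 : ℝ), ENNReal.ofReal (s ^ 2 * Real.exp (-x * s ^ 2)) =
      ENNReal.ofReal (Real.sqrt Real.pi / 4 * x ^ (-(3 : ℝ) / 2)) := by
  have hint := integrableOn_rpow_mul_exp_neg_mul_rpow (s := 2) (p := 2) (by norm_num)
    (by norm_num) hx
  have hval := integral_rpow_mul_exp_neg_mul_rpow (p := 2) (q := 2) (by norm_num) (by norm_num) hx
  simp only [Real.rpow_two] at hint hval
  rw [← ofReal_integral_eq_lintegral_ofReal hint (ae_of_all _ fun s => by positivity), hval,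
    show ((2 : ℝ) + 1) / 2 = 1 / 2 + 1 by norm_num, Real.Gamma_add_one (by norm_num),
    Real.Gamma_one_half_eq]
  norm_num
  ring_nf

theorem lintegral_lintegral_exp_mul_add_rpow {y₁ y₂ : ℝ} (hy₁ : 0 < y₁) (hy₂ : 0 < y₂) :
    ∫⁻ x₂ in Ioi (0 : ℝ), ∫⁻ x₁ in Ioi (0 : ℝ),
        ENNReal.ofReal (Real.exp (-(x₁ * y₁) - x₂ * y₂) * (x₁ + x₂) ^ (-(3 : ℝ) / 2)) =
      ENNReal.ofReal (2 * Real.sqrt Real.pi / (Real.sqrt y₁ + Real.sqrt y₂)) := by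
  set G : ℝ → ℝ → ℝ → ENNReal := fun x₂ x₁ s =>
    ENNReal.ofReal (4 / Real.sqrt Real.pi * s ^ 2) *
      (ENNReal.ofReal (Real.exp (-(y₂ + s ^ 2) * x₂)) *
        ENNReal.ofReal (Real.exp (-(y₁ + s ^ 2) * x₁)))
  have hG : ∀ x₂ ∈ Ioi (0 : ℝ), ∀ x₁ ∈ Ioi (0 : ℝ),
      ENNReal.ofReal (Real.exp (-(x₁ * y₁) - x₂ * y₂) * (x₁ + x₂) ^ (-(3 : ℝ) / 2)) =
        ∫⁻ s in Ioi (0 : ℝ), G x₂ x₁ s := by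
    intro x₂ hx₂ x₁ hx₁
    have hfactor (s : ℝ) : G x₂ x₁ s =
        ENNReal.ofReal (4 / Real.sqrt Real.pi * Real.exp (-(x₁ * y₁) - x₂ * y₂)) *
          ENNReal.ofReal (s ^ 2 * Real.exp (-(x₁ + x₂) * s ^ 2)) := by
      simp only [G]
      rw [← ENNReal.ofReal_mul (by positivity), ← ENNReal.ofReal_mul (by positivity),
        ← ENNReal.ofReal_mul (by positivity), ← Real.exp_add, mul_mul_mul_comm, mul_assoc,
        mul_assoc, ← Real.exp_add]
      ring_nf
    simp_rw [hfactor]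
    rw [lintegral_const_mul _ (by fun_prop),
      lintegral_sq_mul_exp_neg_mul_sq (add_pos hx₁ hx₂), ← ENNReal.ofReal_mul (by positivity)]
    congr 1
    field_simp
  have hinner (s : ℝ) : ∫⁻ x₂ in Ioi (0 : ℝ), ∫⁻ x₁ in Ioi (0 : ℝ), G x₂ x₁ s =
      ENNReal.ofReal (4 / Real.sqrt Real.pi) * ENNReal.ofReal
        (s ^ 2 / ((Real.sqrt y₁ ^ 2 + s ^ 2) * (Real.sqrt y₂ ^ 2 + s ^ 2))) := by
    simp only [G]
    simp_rw [lintegral_const_mul' _ _ ENNReal.ofReal_ne_top]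
    rw [lintegral_exp_neg_mul_Ioi_zero (by positivity), lintegral_mul_const' _ _
      ENNReal.ofReal_ne_top, lintegral_exp_neg_mul_Ioi_zero (by positivity),
      ← ENNReal.ofReal_mul (by positivity), ← ENNReal.ofReal_mul (by positivity),
      ← ENNReal.ofReal_mul (by positivity), Real.sq_sqrt hy₁.le, Real.sq_sqrt hy₂.le]
    congr 1
    field_simp
  calc
    _ = ∫⁻ x₂ in Ioi (0 : ℝ), ∫⁻ x₁ in Ioi (0 : ℝ), ∫⁻ s in Ioi (0 : ℝ), G x₂ x₁ s :=
      setLIntegral_congr_fun measurableSet_Ioi fun x₂ hx₂ =>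
        setLIntegral_congr_fun measurableSet_Ioi fun x₁ hx₁ => hG x₂ hx₂ x₁ hx₁
    _ = ∫⁻ x₂ in Ioi (0 : ℝ), ∫⁻ s in Ioi (0 : ℝ), ∫⁻ x₁ in Ioi (0 : ℝ), G x₂ x₁ s :=
      lintegral_congr fun x₂ => lintegral_lintegral_swap (by fun_prop)
    _ = ∫⁻ s in Ioi (0 : ℝ), ∫⁻ x₂ in Ioi (0 : ℝ), ∫⁻ x₁ in Ioi (0 : ℝ), G x₂ x₁ s :=
      lintegral_lintegral_swap (by
        refine (Measurable.lintegral_prod_right' (f := fun p : (ℝ × ℝ) × ℝ =>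
          G p.1.1 p.2 p.1.2) ?_).aemeasurable
        fun_prop)
    _ = ENNReal.ofReal (2 * Real.sqrt Real.pi / (Real.sqrt y₁ + Real.sqrt y₂)) := by
      simp_rw [hinner]
      rw [lintegral_const_mul' _ _ ENNReal.ofReal_ne_top, lintegral_sq_div_mul_add_sq
        (Real.sqrt_pos.2 hy₁) (Real.sqrt_pos.2 hy₂), ← ENNReal.ofReal_mul (by positivity)]
      congr 1
      have := Real.sqrt_pos.2 hy₁
      have := Real.sqrt_pos.2 hy₂
      field_simp
      rw [Real.sq_sqrt Real.pi_pos.le]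
      ring

theorem integrableOn_exp_mul_add_rpow {y₁ : ℝ} (hy₁ : 0 < y₁) (y₂ : ℝ) {x₂ : ℝ} (hx₂ : 0 < x₂) :
    IntegrableOn (fun x₁ => Real.exp (-(x₁ * y₁) - x₂ * y₂) * (x₁ + x₂) ^ (-(3 : ℝ) / 2))
      (Ioi 0) := by
  refine Integrable.mono' ((integrableOn_exp_mul_Ioi (neg_lt_zero.2 hy₁) 0).mul_const
    (Real.exp (-(x₂ * y₂)) * x₂ ^ (-(3 : ℝ) / 2)))
    (Measurable.aestronglyMeasurable (by fun_prop)) ?_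
  filter_upwards [ae_restrict_mem measurableSet_Ioi] with x₁ hx₁
  have hx₁ : 0 < x₁ := hx₁
  rw [Real.norm_of_nonneg (by positivity), ← mul_assoc, ← Real.exp_add,
    show -y₁ * x₁ + -(x₂ * y₂) = -(x₁ * y₁) - x₂ * y₂ by ring]
  gcongr ?_ * ?_
  exact Real.rpow_le_rpow_of_nonpos hx₂ (by linarith) (by norm_num)

/-- Laplace transform of the perimeter measure: for `y₁, y₂ > 0`,
`∫_0^∞ ∫_0^∞ e^(-x₁ y₁ - x₂ y₂) (x₁ + x₂)^(-3/2) dx₁ dx₂ = 2√π / (√y₁ + √y₂)`. -/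
theorem perimeter_measure_laplace_transform (y₁ y₂ : ℝ) (hy₁ : 0 < y₁) (hy₂ : 0 < y₂) :
    (∫ x₂ in Set.Ioi (0 : ℝ), ∫ x₁ in Set.Ioi (0 : ℝ),
        Real.exp (-(x₁ * y₁) - x₂ * y₂) * (x₁ + x₂) ^ (-(3 : ℝ) / 2)) =
      2 * Real.sqrt Real.pi / (Real.sqrt y₁ + Real.sqrt y₂) := by
  have hnonneg : ∀ x₂ ∈ Ioi (0 : ℝ), 0 ≤ᵐ[volume.restrict (Ioi 0)] fun x₁ : ℝ =>
      Real.exp (-(x₁ * y₁) - x₂ * y₂) * (x₁ + x₂) ^ (-(3 : ℝ) / 2) := by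
    intro x₂ hx₂
    filter_upwards [ae_restrict_mem measurableSet_Ioi] with x₁ hx₁
    have := add_pos (mem_Ioi.1 hx₁) (mem_Ioi.1 hx₂)
    simp only [Pi.zero_apply]
    positivity
  have hmeas : StronglyMeasurable fun x₂ : ℝ => ∫ x₁ in Ioi (0 : ℝ),
      Real.exp (-(x₁ * y₁) - x₂ * y₂) * (x₁ + x₂) ^ (-(3 : ℝ) / 2) :=
    StronglyMeasurable.integral_prod_right' (f := fun p : ℝ × ℝ =>
      Real.exp (-(p.2 * y₁) - p.1 * y₂) * (p.2 + p.1) ^ (-(3 : ℝ) / 2))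
      (Measurable.stronglyMeasurable (by fun_prop))
  rw [integral_eq_lintegral_of_nonneg_ae _ hmeas.aestronglyMeasurable,
    setLIntegral_congr_fun measurableSet_Ioi fun x₂ hx₂ => ofReal_integral_eq_lintegral_ofReal
      (integrableOn_exp_mul_add_rpow hy₁ y₂ hx₂) (hnonneg x₂ hx₂),
    lintegral_lintegral_exp_mul_add_rpow hy₁ hy₂, ENNReal.toReal_ofReal (by positivity)]
  filter_upwards [ae_restrict_mem measurableSet_Ioi] with x₂ hx₂
  exact integral_nonneg_of_ae (hnonneg x₂ hx₂)
end

section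
/- For every x > 0, as n → ∞ the proportion of doubly rooted trees (T, r, t) on the vertex set {1, …, n} whose trunk has at most x·√n vertices (i.e. dist_T(r, t) + 1 ≤ x√n), among all (n−1)·n^{n−1} doubly rooted trees, converges to 1 − e^{−x²/2}. (The normalized trunk height of a uniformly random doubly rooted tree converges in distribution to a Rayleigh random variable with density x e^{−x²/2} dx on (0, ∞).) -/
section RootedForest

variable {V : Type*}

/-- `f` is the parent map of a forest on `V` whose set of roots is `S`. -/
def IsRootedForest (S : Finset V) (f : V → V) : Prop :=
  (∀ s ∈ S, f s = s) ∧ ∀ v, ∃ m, f^[m] v ∈ S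

namespace IsRootedForest

variable {S : Finset V} {f : V → V}

theorem exists_first_hit (hf : IsRootedForest S f) (r : V) :
    ∃ m, f^[m] r ∈ S ∧ ∀ i < m, f^[i] r ∉ S := by
  classical
  exact ⟨Nat.find (hf.2 r), Nat.find_spec (hf.2 r), fun i hi => Nat.find_min (hf.2 r) hi⟩

theorem iterate_of_mem (hf : IsRootedForest S f) {s : V} (hs : s ∈ S) (k : ℕ) : f^[k] s = s :=
  Function.iterate_fixed (hf.1 s hs) k

theorem iterate_eq_of_le (hf : IsRootedForest S f) {r : V} {m k : ℕ} (hm : f^[m] r ∈ S)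
    (hk : m ≤ k) : f^[k] r = f^[m] r := by
  obtain ⟨d, rfl⟩ := Nat.exists_eq_add_of_le' hk
  rw [Function.iterate_add_apply, hf.iterate_of_mem hm]

theorem iterate_eq_of_mem (hf : IsRootedForest S f) {r : V} {m k : ℕ} (hm : f^[m] r ∈ S)
    (hk : f^[k] r ∈ S) : f^[k] r = f^[m] r := by
  rcases le_total m k with h | h
  · exact hf.iterate_eq_of_le hm h
  · exact (hf.iterate_eq_of_le hk h).symm

end IsRootedForest

theorem Function.update_iterate_of_ne [DecidableEq V] {f : V → V} {w x r : V} {m : ℕ}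
    (h : ∀ i < m, f^[i] r ≠ w) {i : ℕ} (hi : i ≤ m) : (Function.update f w x)^[i] r = f^[i] r := by
  induction i with
  | zero => rfl
  | succ i ih =>
    rw [Function.iterate_succ_apply', Function.iterate_succ_apply', ih (by omega),
      Function.update_of_ne (h i (by omega))]

namespace IsRootedForest

variable [DecidableEq V] {S : Finset V} {f : V → V}

theorem update_self (hf : IsRootedForest S f) (w : V) :
    IsRootedForest (insert w S) (Function.update f w w) := by
  refine ⟨fun s hs => ?_, fun u => ?_⟩
  · by_cases h : s = w
    · simp [h]
    · simp [h, hf.1 s (by simpa [h] using hs)]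
  · have hex : ∃ m, f^[m] u ∈ insert w S := (hf.2 u).imp fun m hm => Finset.mem_insert_of_mem hm
    refine ⟨Nat.find hex, ?_⟩
    rw [Function.update_iterate_of_ne (m := Nat.find hex) (fun i hi h => ?_) le_rfl]
    · exact Nat.find_spec hex
    · exact Nat.find_min hex hi (by simp [h])

theorem update_of_insert {w v : V} (hw : w ∉ S) (hv : v ∈ S)
    (hf : IsRootedForest (insert w S) f) : IsRootedForest S (Function.update f w v) := by
  refine ⟨fun s hs => ?_, fun u => ?_⟩
  · have h : s ≠ w := fun h => hw (h ▸ hs)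
    simp [h, hf.1 s (Finset.mem_insert_of_mem hs)]
  · obtain ⟨m, hm, hlt⟩ := hf.exists_first_hit u
    have key : (Function.update f w v)^[m] u = f^[m] u :=
      Function.update_iterate_of_ne (fun i hi h => hlt i hi (by simp [h])) le_rfl
    rcases Finset.mem_insert.1 hm with h | h
    · exact ⟨m + 1, by rw [Function.iterate_succ_apply', key, h]; simpa using hv⟩
    · exact ⟨m, key ▸ h⟩

end IsRootedForest

variable [Fintype V]

open Classical in
/-- Parent maps of forests on `V` with set of roots `S`. -/
noncomputable def rootedForests (S : Finset V) : Finset (V → V) :=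
  {f | IsRootedForest S f}

open Classical in
/-- Pairs of a forest with set of roots `S` and a vertex of depth at least `j` in the tree
rooted at `v`. -/
noncomputable def deepVertices (S : Finset V) (v : V) (j : ℕ) : Finset ((V → V) × V) :=
  {p | IsRootedForest S p.1 ∧ (∃ m, p.1^[m] p.2 = v) ∧ ∀ i < j, p.1^[i] p.2 ∉ S}

theorem mem_deepVertices {S : Finset V} {v : V} {j : ℕ} {p : (V → V) × V} :
    p ∈ deepVertices S v j ↔
      IsRootedForest S p.1 ∧ (∃ m, p.1^[m] p.2 = v) ∧ ∀ i < j, p.1^[i] p.2 ∉ S := by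
  simp [deepVertices]

theorem card_deepVertices_succ [DecidableEq V] {S : Finset V} {v : V} (hv : v ∈ S) (j : ℕ) :
    (deepVertices S v (j + 1)).card = ∑ w ∈ Sᶜ, (deepVertices (insert w S) w j).card := by
  rw [← Finset.card_sigma]
  symm
  -- the parent of the last vertex `w` outside `S` is reset from `w` to `v`
  have image_spec : ∀ a ∈ Sᶜ.sigma fun w => deepVertices (insert w S) w j,
      IsRootedForest S (Function.update a.2.1 a.1 v) ∧
      ∃ m, j ≤ m ∧ (Function.update a.2.1 a.1 v)^[m] a.2.2 = a.1 ∧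
        (Function.update a.2.1 a.1 v)^[m + 1] a.2.2 = v ∧
        ∀ i ≤ m, (Function.update a.2.1 a.1 v)^[i] a.2.2 ∉ S := by
    rintro ⟨w, f, r⟩ ha
    simp only [Finset.mem_sigma, Finset.mem_compl, mem_deepVertices] at ha ⊢
    obtain ⟨hw, hf, ⟨k, hk⟩, hj⟩ := ha
    obtain ⟨m, hm, hlt⟩ := hf.exists_first_hit r
    have hmw : f^[m] r = w := by
      rw [← hf.iterate_eq_of_mem hm (k := k) (by simp [hk]), hk]
    have key : ∀ i ≤ m, (Function.update f w v)^[i] r = f^[i] r := fun i hi =>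
      Function.update_iterate_of_ne (fun i hi h => hlt i hi (by simp [h])) hi
    refine ⟨hf.update_of_insert hw hv, m, ?_, by rw [key m le_rfl, hmw], ?_, fun i hi => ?_⟩
    · by_contra! h
      exact hj m h hm
    · rw [Function.iterate_succ_apply', key m le_rfl, hmw]; simp
    · rw [key i hi]
      rcases hi.lt_or_eq with h | rfl
      · exact fun h' => hlt i h (Finset.mem_insert_of_mem h')
      · rwa [hmw]
  refine Finset.card_bij (fun a _ => (Function.update a.2.1 a.1 v, a.2.2)) ?_ ?_ ?_
  · intro a ha
    obtain ⟨hf, m, hjm, -, hm, hi⟩ := image_spec a ha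
    exact mem_deepVertices.2 ⟨hf, ⟨m + 1, hm⟩, fun i hij => hi i (by omega)⟩
  · intro a ha b hb hab
    obtain ⟨hf, m, -, hma, hma', hia⟩ := image_spec a ha
    obtain ⟨-, k, -, hkb, hkb', hib⟩ := image_spec b hb
    obtain ⟨w, f, r⟩ := a
    obtain ⟨w', f', r'⟩ := b
    simp only [Prod.mk.injEq] at hab hma hma' hia hkb hkb' hib hf
    obtain ⟨hab, rfl⟩ := hab
    rw [← hab] at hkb hkb' hib
    generalize hg : Function.update f w v = g at *
    have hmk : m = k := by
      rcases lt_trichotomy m k with h | h | h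
      · exact absurd hv (hma' ▸ hib (m + 1) h)
      · exact h
      · exact absurd hv (hkb' ▸ hia (k + 1) h)
    obtain rfl : w = w' := by rw [← hma, ← hkb, hmk]
    simp only [Finset.mem_sigma, mem_deepVertices] at ha hb
    have h1 := ha.2.1.1 w (by simp)
    have h2 := hb.2.1.1 w (by simp)
    have : f = f' := by
      ext u
      by_cases hu : u = w
      · rw [hu, h1, h2]
      · simpa [← hg, hu] using congrFun hab u
    rw [this]
  · rintro ⟨f, r⟩ hfr
    obtain ⟨hf, ⟨k, hk⟩, hj⟩ := mem_deepVertices.1 hfr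
    simp only at hf hk hj
    obtain ⟨m, hm, hlt⟩ := hf.exists_first_hit r
    have hmv : f^[m] r = v := by
      rw [← hf.iterate_eq_of_mem hm (k := k) (by rwa [hk]), hk]
    have hjm : j + 1 ≤ m := by
      by_contra! h
      exact hj m h hm
    obtain ⟨m, rfl⟩ : ∃ m', m = m' + 1 := ⟨m - 1, by omega⟩
    obtain ⟨w, hw⟩ : ∃ w, w = f^[m] r := ⟨_, rfl⟩
    have hfw : f w = v := by rw [hw, ← Function.iterate_succ_apply' f, hmv]
    have hne : ∀ i < m, f^[i] r ≠ w := fun i hi h =>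
      hlt (i + 1) (by omega) (by rw [Function.iterate_succ_apply', h, hfw]; exact hv)
    have key : ∀ i ≤ m, (Function.update f w w)^[i] r = f^[i] r := fun i hi =>
      Function.update_iterate_of_ne hne hi
    refine ⟨⟨w, Function.update f w w, r⟩, ?_, ?_⟩
    · simp only [Finset.mem_sigma, Finset.mem_compl, mem_deepVertices]
      refine ⟨hw ▸ hlt m (by omega), hf.update_self w, ⟨m, by rw [key m le_rfl, hw]⟩, ?_⟩
      intro i hi
      rw [key i (by omega), Finset.mem_insert, not_or]
      exact ⟨hne i (by omega), hlt i (by omega)⟩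
    · simp [← hfw]

theorem card_deepVertices_zero [DecidableEq V] {S : Finset V} {v : V} (hv : v ∈ S) :
    (deepVertices S v 0).card = (rootedForests S).card + (deepVertices S v 1).card := by
  classical
  rw [← Finset.card_filter_add_card_filter_not (s := deepVertices S v 0) (fun p => p.2 ∈ S)]
  congr 1
  · refine Finset.card_bij' (fun p _ => p.1) (fun f _ => (f, v)) ?_ ?_ ?_ ?_
    · simp +contextual [rootedForests, deepVertices]
    · simp only [rootedForests, deepVertices, Finset.mem_filter, Finset.mem_univ, true_and]
      exact fun f hf => ⟨⟨hf, ⟨0, rfl⟩, by simp⟩, hv⟩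
    · rintro ⟨f, r⟩ h
      simp only [deepVertices, Finset.mem_filter, Finset.mem_univ, true_and] at h
      obtain ⟨⟨hf, ⟨m, hm⟩, -⟩, hr⟩ := h
      rw [hf.iterate_of_mem hr] at hm
      simp [hm]
    · simp
  · congr 1
    ext p
    simp [deepVertices, and_assoc]

theorem sum_card_deepVertices_zero (S : Finset V) :
    ∑ v ∈ S, (deepVertices S v 0).card = (rootedForests S).card * Fintype.card V := by
  classical
  rw [← Finset.card_univ (α := V), ← Finset.card_product, ← Finset.card_biUnion]
  · congr 1
    ext ⟨f, r⟩
    simp only [Finset.mem_biUnion, mem_deepVertices, rootedForests, Finset.mem_product,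
      Finset.mem_filter, Finset.mem_univ, true_and, and_true, not_lt_zero, IsEmpty.forall_iff,
      implies_true]
    constructor
    · rintro ⟨v, -, hf, -⟩
      exact hf
    · intro hf
      obtain ⟨m, hm⟩ := hf.2 r
      exact ⟨_, hm, hf, m, rfl⟩
  · intro v hv w hw hvw
    refine Finset.disjoint_left.2 fun p hp hp' => hvw ?_
    obtain ⟨hf, ⟨m, hm⟩, -⟩ := mem_deepVertices.1 hp
    obtain ⟨-, ⟨k, hk⟩, -⟩ := mem_deepVertices.1 hp'
    rw [← hm, ← hk]
    exact hf.iterate_eq_of_mem (hk ▸ hw) (hm ▸ hv)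

theorem card_deepVertices_zero_eq_pow {S : Finset V} {v : V} (hv : v ∈ S) :
    (deepVertices S v 0).card = Fintype.card V ^ (Fintype.card V - S.card) := by
  classical
  induction hk : Fintype.card V - S.card generalizing S v with
  | zero =>
    have hS : S = Finset.univ := by
      rw [← Finset.card_eq_iff_eq_univ]
      have := S.card_le_univ
      omega
    rw [pow_zero, Finset.card_eq_one]
    refine ⟨(id, v), ?_⟩
    ext ⟨f, r⟩
    simp only [mem_deepVertices, Finset.mem_singleton, Prod.mk.injEq]
    constructor
    · rintro ⟨hf, ⟨m, hm⟩, -⟩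
      rw [hf.iterate_of_mem (by simp [hS])] at hm
      exact ⟨funext fun s => hf.1 s (by simp [hS]), hm⟩
    · rintro ⟨rfl, rfl⟩
      exact ⟨⟨by simp, by simp [hS]⟩, ⟨0, rfl⟩, by simp⟩
  | succ k ih =>
    have h1 : ∀ u ∈ S, (deepVertices S u 1).card = (k + 1) * Fintype.card V ^ k := by
      intro u hu
      rw [card_deepVertices_succ hu 0, Finset.sum_congr rfl
        (g := fun _ => Fintype.card V ^ k) fun w hw => ?_]
      · rw [Finset.sum_const, Finset.card_compl, hk, smul_eq_mul]
      · refine ih (Finset.mem_insert_self w S) ?_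
        rw [Finset.card_insert_of_notMem (by simpa using hw)]
        omega
    have htot := sum_card_deepVertices_zero S
    rw [Finset.sum_congr rfl (g := fun _ => (rootedForests S).card +
      (k + 1) * Fintype.card V ^ k) fun u hu => by rw [card_deepVertices_zero hu, h1 u hu],
      Finset.sum_const, smul_eq_mul] at htot
    rw [card_deepVertices_zero hv, h1 v hv]
    have hn : Fintype.card V = S.card + (k + 1) := by omega
    have hF : (rootedForests S).card = S.card * Fintype.card V ^ k := by
      refine Nat.eq_of_mul_eq_mul_left k.succ_pos ?_
      generalize Fintype.card V ^ k = N at *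
      rw [hn] at htot
      simp only [Nat.succ_eq_add_one]
      linarith
    rw [hF, pow_succ]
    nth_rewrite 4 [hn]
    ring

theorem card_deepVertices {S : Finset V} {v : V} (hv : v ∈ S) (j : ℕ) :
    (deepVertices S v j).card = (Fintype.card V - S.card).descFactorial j *
      Fintype.card V ^ (Fintype.card V - S.card - j) := by
  classical
  induction j generalizing S v with
  | zero => simp [card_deepVertices_zero_eq_pow hv]
  | succ j ih =>
    rw [card_deepVertices_succ hv, Finset.sum_congr rfl fun w hw => by
      rw [ih (Finset.mem_insert_self w S),
        Finset.card_insert_of_notMem (by simpa using hw)],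
      Finset.sum_const, Finset.card_compl, smul_eq_mul]
    rcases h : Fintype.card V - S.card with _ | k
    · simp
    · rw [Nat.succ_descFactorial_succ, show Fintype.card V - (S.card + 1) = k by omega,
        Nat.add_sub_add_right, mul_assoc]

end RootedForest

section ParentGraph

variable {V : Type*} {f g : V → V} {t r : V}

/-- The graph whose edges join each vertex to its image under `f`. -/
def parentGraph (f : V → V) : SimpleGraph V :=
  SimpleGraph.fromRel fun u v => f u = v

theorem parentGraph_adj {u v : V} :
    (parentGraph f).Adj u v ↔ u ≠ v ∧ (f u = v ∨ f v = u) :=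
  SimpleGraph.fromRel_adj _ _ _

theorem iterate_length_eq_of_walk (ht : f t = t) {r : V} (p : (parentGraph f).Walk r t) :
    f^[p.length] r = t := by
  induction p with
  | nil => rfl
  | @cons r u t h p ih =>
    have ih := ih ht
    rw [SimpleGraph.Walk.length_cons]
    rcases (parentGraph_adj.1 h).2 with h | h
    · rw [Function.iterate_succ_apply, h, ih]
    · rw [← h, ← Function.iterate_succ_apply f, Function.iterate_succ_apply',
        Function.iterate_succ_apply', ih, ht, ht]

theorem exists_walk_length_le_of_iterate_eq {m : ℕ} (h : f^[m] r = t) :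
    ∃ p : (parentGraph f).Walk r t, p.length ≤ m := by
  induction m generalizing r with
  | zero =>
    obtain rfl : r = t := h
    exact ⟨.nil, le_rfl⟩
  | succ m ih =>
    obtain ⟨p, hp⟩ := ih (r := f r) (by rwa [← Function.iterate_succ_apply])
    by_cases hr : f r = r
    · exact ⟨p.copy hr rfl, by rw [SimpleGraph.Walk.length_copy]; omega⟩
    · exact ⟨.cons (parentGraph_adj.2 ⟨Ne.symm hr, .inl rfl⟩) p, by simpa using hp⟩

namespace IsRootedForest

theorem connected_parentGraph (hf : IsRootedForest {t} f) : (parentGraph f).Connected := by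
  have h : ∀ r, (parentGraph f).Reachable r t := fun r => by
    obtain ⟨m, hm⟩ := hf.2 r
    exact ⟨(exists_walk_length_le_of_iterate_eq (Finset.mem_singleton.1 hm)).choose⟩
  have : Nonempty V := ⟨t⟩
  exact ⟨fun u v => (h u).trans (h v).symm⟩

theorem dist_le_iff (hf : IsRootedForest {t} f) {m : ℕ} :
    (parentGraph f).dist r t ≤ m ↔ f^[m] r = t := by
  constructor
  · intro h
    obtain ⟨p, hp⟩ := hf.connected_parentGraph.exists_walk_length_eq_dist r t
    have := iterate_length_eq_of_walk (hf.1 t (by simp)) p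
    rw [hf.iterate_eq_of_le (by simp [this]) (hp ▸ h), this]
  · intro h
    obtain ⟨p, hp⟩ := exists_walk_length_le_of_iterate_eq h
    exact (SimpleGraph.dist_le p).trans hp

theorem le_dist_iff (hf : IsRootedForest {t} f) {j : ℕ} :
    j ≤ (parentGraph f).dist r t ↔ ∀ i < j, f^[i] r ∉ ({t} : Finset V) := by
  simp only [Finset.mem_singleton, ← hf.dist_le_iff, not_le]
  exact ⟨fun h i hi => hi.trans_le h, fun h => le_of_not_gt fun h' => lt_irrefl _ (h _ h')⟩

theorem dist_eq_succ (hf : IsRootedForest {t} f) (hr : r ≠ t) :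
    (parentGraph f).dist r t = (parentGraph f).dist (f r) t + 1 := by
  have h0 := hf.connected_parentGraph.pos_dist_of_ne hr
  have h (m : ℕ) : (parentGraph f).dist r t ≤ m + 1 ↔ (parentGraph f).dist (f r) t ≤ m := by
    rw [hf.dist_le_iff, hf.dist_le_iff, Function.iterate_succ_apply]
  have h1 := (h _).2 le_rfl
  have h2 := (h ((parentGraph f).dist r t - 1)).1 (by omega)
  omega

theorem parentGraph_injective (hf : IsRootedForest {t} f) (hg : IsRootedForest {t} g)
    (h : parentGraph f = parentGraph g) : f = g := by
  ext v
  by_cases hv : v = t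
  · rw [hv, hf.1 t (by simp), hg.1 t (by simp)]
  have hd := hf.dist_eq_succ hv
  have hadj : (parentGraph f).Adj v (f v) :=
    parentGraph_adj.2 ⟨fun h' => by rw [← h'] at hd; omega, .inl rfl⟩
  rw [h] at hadj
  rcases (parentGraph_adj.1 hadj).2 with h' | h'
  · exact h'.symm
  · have hne : f v ≠ t := fun h'' => hv (by rw [← h', h'', hg.1 t (by simp)])
    have hd' := hg.dist_eq_succ hne
    rw [h', ← h] at hd'
    omega

theorem isTree_parentGraph [Finite V] (hf : IsRootedForest {t} f) : (parentGraph f).IsTree := by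
  classical
  have := Fintype.ofFinite V
  rw [SimpleGraph.isTree_iff_connected_and_card]
  refine ⟨hf.connected_parentGraph, le_antisymm ?_
    hf.connected_parentGraph.card_vert_le_card_edgeSet_add_one⟩
  have hsub : (parentGraph f).edgeSet ⊆
      ((Finset.univ.erase t).image fun v => s(v, f v) : Finset (Sym2 V)) := by
    intro e
    induction e with | _ a b
    rw [SimpleGraph.mem_edgeSet, parentGraph_adj]
    have ht := hf.1 t (by simp)
    rintro ⟨hne, rfl | rfl⟩
    · simp only [Finset.coe_image, Set.mem_image, Finset.mem_coe, Finset.mem_erase]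
      exact ⟨a, ⟨fun h => hne (by rw [h, ht]), by simp⟩, rfl⟩
    · simp only [Finset.coe_image, Set.mem_image, Finset.mem_coe, Finset.mem_erase]
      exact ⟨b, ⟨fun h => hne (by rw [h, ht]), by simp⟩, Sym2.eq_swap⟩
  have h1 := Set.ncard_le_ncard hsub (Finset.finite_toSet _)
  rw [Set.ncard_coe_finset] at h1
  have h2 := h1.trans Finset.card_image_le
  rw [Finset.card_erase_of_mem (Finset.mem_univ t), Finset.card_univ] at h2
  have : 0 < Fintype.card V := Fintype.card_pos_iff.2 ⟨t⟩
  rw [Nat.card_coe_set_eq, Nat.card_eq_fintype_card]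
  omega

end IsRootedForest

theorem SimpleGraph.IsTree.exists_isRootedForest {G : SimpleGraph V} (hG : G.IsTree) (t : V) :
    ∃ f, IsRootedForest {t} f ∧ parentGraph f = G := by
  classical
  have step : ∀ v, ∃ w, (v = t → w = t) ∧ (v ≠ t → G.Adj v w ∧ G.dist w t < G.dist v t) := by
    intro v
    by_cases hv : v = t
    · exact ⟨t, by simp [hv]⟩
    obtain ⟨p, hp⟩ := hG.connected.exists_walk_length_eq_dist v t
    cases p with
    | nil => exact absurd rfl hv
    | @cons _ w _ h p =>
      refine ⟨w, fun h' => absurd h' hv, fun _ => ⟨h, ?_⟩⟩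
      rw [← hp, SimpleGraph.Walk.length_cons]
      exact Nat.lt_succ_of_le (SimpleGraph.dist_le p)
  choose f hft hf using step
  have hforest : IsRootedForest {t} f := by
    refine ⟨by simpa using hft t rfl, fun v => ?_⟩
    induction hd : G.dist v t using Nat.strong_induction_on generalizing v with
    | _ d ih =>
      by_cases hv : v = t
      · exact ⟨0, by simp [hv]⟩
      · obtain ⟨m, hm⟩ := ih _ (hd ▸ (hf v hv).2) (f v) rfl
        exact ⟨m + 1, hm⟩
  have hle : parentGraph f ≤ G := by
    have key : ∀ u, u ≠ f u → G.Adj u (f u) := fun u hu =>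
      (hf u fun h => hu (by rw [hft u h, h])).1
    intro u v huv
    obtain ⟨hne, rfl | rfl⟩ := parentGraph_adj.1 huv
    · exact key u hne
    · exact (key v hne.symm).symm
  exact ⟨f, hforest, le_antisymm hle
    ((SimpleGraph.isTree_iff_minimal_connected.1 hG).2 hforest.connected_parentGraph hle)⟩

/-- The number of doubly rooted trees whose root and top are at distance at least `j`. -/
theorem card_tree_le_dist [Fintype V] [Nonempty V] (j : ℕ) :
    Nat.card {p : SimpleGraph V × V × V // p.1.IsTree ∧ j ≤ p.1.dist p.2.1 p.2.2} =
      (Fintype.card V).descFactorial (j + 1) * Fintype.card V ^ (Fintype.card V - (j + 1)) := by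
  classical
  have := Fintype.ofFinite (SimpleGraph V)
  rw [Nat.card_eq_fintype_card, Fintype.card_subtype]
  trans (Finset.univ.sigma fun t : V => deepVertices {t} t j).card
  · symm
    refine Finset.card_bij (fun a _ => (parentGraph a.2.1, a.2.2, a.1)) ?_ ?_ ?_
    · rintro ⟨t, f, r⟩ h
      simp only [Finset.mem_sigma, mem_deepVertices, Finset.mem_univ, true_and] at h
      simp only [Finset.mem_filter, Finset.mem_univ, true_and]
      exact ⟨h.1.isTree_parentGraph, h.1.le_dist_iff.2 h.2.2⟩
    · rintro ⟨t, f, r⟩ h ⟨t', f', r'⟩ h' heq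
      simp only [Finset.mem_sigma, mem_deepVertices, Finset.mem_univ, true_and] at h h'
      simp only [Prod.mk.injEq] at heq
      obtain ⟨heq, rfl, rfl⟩ := heq
      rw [h.1.parentGraph_injective h'.1 heq]
    · rintro ⟨G, r, t⟩ h
      simp only [Finset.mem_filter, Finset.mem_univ, true_and] at h
      obtain ⟨f, hf, rfl⟩ := h.1.exists_isRootedForest t
      refine ⟨⟨t, f, r⟩, ?_, rfl⟩
      simp only [Finset.mem_sigma, mem_deepVertices, Finset.mem_univ, true_and]
      exact ⟨hf, (hf.2 r).imp fun m => Finset.mem_singleton.1, hf.le_dist_iff.1 h.2⟩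
  · simp only [Finset.card_sigma, card_deepVertices (Finset.mem_singleton_self _),
      Finset.card_singleton, Finset.sum_const, Finset.card_univ, smul_eq_mul]
    obtain ⟨n, hn⟩ : ∃ n, Fintype.card V = n + 1 :=
      ⟨Fintype.card V - 1, by have := Fintype.card_pos (α := V); omega⟩
    rw [hn, Nat.succ_descFactorial_succ, Nat.add_sub_cancel, Nat.add_sub_add_right, mul_assoc]

end ParentGraph

section Birthday

open Filter Topology

theorem Nat.cast_descFactorial_eq_pow_mul_prod {n k : ℕ} (hk : k ≤ n) :
    (n.descFactorial k : ℝ) = (n : ℝ) ^ k * ∏ i ∈ Finset.range k, (1 - (i : ℝ) / n) := by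
  rw [Nat.descFactorial_eq_prod_range, Nat.cast_prod, Finset.pow_eq_prod_const,
    ← Finset.prod_mul_distrib]
  refine Finset.prod_congr rfl fun i hi => ?_
  have hi := Finset.mem_range.1 hi
  have hn : (n : ℝ) ≠ 0 := by exact_mod_cast (show n ≠ 0 by omega)
  rw [Nat.cast_sub (by omega)]
  field_simp

theorem sum_range_succ_div (k : ℕ) (c : ℝ) :
    ∑ i ∈ Finset.range (k + 1), (i : ℝ) / c = (k : ℝ) * (k + 1) / (2 * c) := by
  induction k with
  | zero => simp
  | succ k ih =>
    rw [Finset.sum_range_succ, ih]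
    by_cases hc : c = 0
    · simp [hc]
    · push_cast
      field_simp
      ring

theorem prod_one_sub_div_le (n k : ℕ) (hk : k < n) :
    ∏ i ∈ Finset.range (k + 1), (1 - (i : ℝ) / n) ≤
      Real.exp (-((k : ℝ) * (k + 1) / (2 * n))) := by
  rw [← sum_range_succ_div, ← Finset.sum_neg_distrib, Real.exp_sum]
  have hn : (0 : ℝ) < n := by exact_mod_cast (Nat.zero_le k).trans_lt hk
  refine Finset.prod_le_prod (fun i hi => ?_) fun i hi => Real.one_sub_le_exp_neg _
  have hi : (i : ℝ) ≤ n := by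
    exact_mod_cast (show i ≤ n by have := Finset.mem_range.1 hi; omega)
  rw [sub_nonneg, div_le_one hn]
  exact hi

theorem exp_le_prod_one_sub_div (n k : ℕ) (hk : k < n) :
    Real.exp (-((k : ℝ) * (k + 1) / (2 * ((n : ℝ) - k)))) ≤
      ∏ i ∈ Finset.range (k + 1), (1 - (i : ℝ) / n) := by
  rw [← sum_range_succ_div, ← Finset.sum_neg_distrib, Real.exp_sum]
  have hkn : (0 : ℝ) < (n : ℝ) - k := by
    rw [sub_pos]; exact_mod_cast hk
  have hn : (0 : ℝ) < n := by exact_mod_cast (Nat.zero_le k).trans_lt hk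
  refine Finset.prod_le_prod (fun i hi => (Real.exp_pos _).le) fun i hi => ?_
  have hi : (i : ℝ) ≤ k := by
    exact_mod_cast (show i ≤ k by have := Finset.mem_range.1 hi; omega)
  have hin : (0 : ℝ) < (n : ℝ) - i := by linarith
  rw [Real.exp_neg, inv_le_comm₀ (Real.exp_pos _) (by rw [sub_pos, div_lt_one hn]; linarith)]
  calc (1 - (i : ℝ) / n)⁻¹ = (i : ℝ) / ((n : ℝ) - i) + 1 := by field_simp; ring
    _ ≤ (i : ℝ) / ((n : ℝ) - k) + 1 := by gcongr
    _ ≤ _ := Real.add_one_le_exp _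

theorem tendsto_sqrt_natCast : Tendsto (fun n : ℕ => √(n : ℝ)) atTop atTop :=
  Real.tendsto_sqrt_atTop.comp tendsto_natCast_atTop_atTop

theorem tendsto_inv_sqrt_natCast : Tendsto (fun n : ℕ => (√(n : ℝ))⁻¹) atTop (𝓝 0) :=
  tendsto_sqrt_natCast.inv_tendsto_atTop

theorem tendsto_floor_mul_sqrt_div_sqrt {x : ℝ} (hx : 0 < x) :
    Tendsto (fun n : ℕ => (⌊x * √n⌋₊ : ℝ) / √n) atTop (𝓝 x) :=
  (tendsto_nat_floor_mul_div_atTop hx.le).comp tendsto_sqrt_natCast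

theorem tendsto_floor_mul_sqrt_div {x : ℝ} (hx : 0 < x) :
    Tendsto (fun n : ℕ => (⌊x * √n⌋₊ : ℝ) / n) atTop (𝓝 0) := by
  have h := (tendsto_floor_mul_sqrt_div_sqrt hx).mul tendsto_inv_sqrt_natCast
  rw [mul_zero] at h
  refine h.congr fun n => ?_
  rw [div_eq_mul_inv, div_eq_mul_inv, mul_assoc, ← mul_inv, Real.mul_self_sqrt n.cast_nonneg]

theorem eventually_floor_mul_sqrt_lt {x : ℝ} (hx : 0 < x) :
    ∀ᶠ n : ℕ in atTop, ⌊x * √n⌋₊ < n := by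
  filter_upwards [(tendsto_floor_mul_sqrt_div hx).eventually_lt_const one_pos,
    eventually_gt_atTop 0] with n hn hn0
  rw [div_lt_one (by exact_mod_cast hn0)] at hn
  exact_mod_cast hn

/-- The probability that `⌊x√n⌋ + 1` uniform samples from `n` values are pairwise distinct
tends to `exp (-x² / 2)`. -/
theorem tendsto_prod_one_sub_div {x : ℝ} (hx : 0 < x) :
    Tendsto (fun n : ℕ => ∏ i ∈ Finset.range (⌊x * √n⌋₊ + 1), (1 - (i : ℝ) / n)) atTop
      (𝓝 (Real.exp (-x ^ 2 / 2))) := by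
  have hs0 := tendsto_inv_sqrt_natCast
  have hK := tendsto_floor_mul_sqrt_div_sqrt hx
  have hK0 := tendsto_floor_mul_sqrt_div hx
  have hlt := eventually_floor_mul_sqrt_lt hx
  have hquad : Tendsto (fun n : ℕ => (⌊x * √n⌋₊ : ℝ) * (⌊x * √n⌋₊ + 1) / (2 * n)) atTop
      (𝓝 (x ^ 2 / 2)) := by
    have h := (hK.mul (hK.add hs0)).div_const 2
    rw [add_zero, ← sq] at h
    refine h.congr' ?_
    filter_upwards [tendsto_sqrt_natCast.eventually_gt_atTop 0] with n hn
    have hsq : (n : ℝ) = √n * √n := (Real.mul_self_sqrt n.cast_nonneg).symm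
    generalize (⌊x * √n⌋₊ : ℝ) = K, √(n : ℝ) = s at *
    rw [hsq]
    field_simp
  have hquad' : Tendsto (fun n : ℕ => (⌊x * √n⌋₊ : ℝ) * (⌊x * √n⌋₊ + 1) /
      (2 * ((n : ℝ) - ⌊x * √n⌋₊))) atTop (𝓝 (x ^ 2 / 2)) := by
    have h := hquad.div (hK0.const_sub 1) (by norm_num)
    rw [sub_zero, div_one] at h
    refine h.congr' ?_
    filter_upwards [hlt] with n hn
    have h1 : (0 : ℝ) < (n : ℝ) - ⌊x * √n⌋₊ := by rw [sub_pos]; exact_mod_cast hn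
    have h2 : (0 : ℝ) < n := by exact_mod_cast (Nat.zero_le _).trans_lt hn
    simp only [Pi.div_apply]
    field_simp
  rw [neg_div]
  refine tendsto_of_tendsto_of_tendsto_of_le_of_le'
    ((Real.continuous_exp.tendsto _).comp hquad'.neg)
    ((Real.continuous_exp.tendsto _).comp hquad.neg) ?_ ?_
  · filter_upwards [hlt] with n hn using exp_le_prod_one_sub_div n _ hn
  · filter_upwards [hlt] with n hn using prod_one_sub_div_le n _ hn

end Birthday

/-- Doubly rooted trees with a trunk of at most `y` vertices, as a difference of tail counts. -/
theorem card_short_trunk_add {n : ℕ} {y : ℝ} (hn : 0 < n) (hy : 1 ≤ y) :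
    Nat.card {p : SimpleGraph (Fin n) × Fin n × Fin n //
        (p.1.Connected ∧ p.1.IsAcyclic) ∧ p.2.1 ≠ p.2.2 ∧
        ((p.1.dist p.2.1 p.2.2 + 1 : ℕ) : ℝ) ≤ y} +
      n.descFactorial (⌊y⌋₊ + 1) * n ^ (n - (⌊y⌋₊ + 1)) = n.descFactorial 2 * n ^ (n - 2) := by
  classical
  have : Nonempty (Fin n) := ⟨⟨0, hn⟩⟩
  have := Fintype.ofFinite (SimpleGraph (Fin n))
  have h1 := card_tree_le_dist (V := Fin n) 1
  have hK := card_tree_le_dist (V := Fin n) ⌊y⌋₊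
  rw [Fintype.card_fin] at h1 hK
  rw [← h1, ← hK]
  simp only [Nat.card_eq_fintype_card, Fintype.card_subtype]
  rw [← Finset.card_union_of_disjoint]
  · congr 1
    ext ⟨G, r, t⟩
    simp only [Finset.mem_union, Finset.mem_filter, Finset.mem_univ, true_and,
      SimpleGraph.isTree_iff, ← Nat.le_floor_iff (zero_le_one.trans hy)]
    have hfl : 1 ≤ ⌊y⌋₊ := Nat.one_le_floor_iff _ |>.2 hy
    by_cases hG : G.Connected
    · have := hG.dist_eq_zero_iff (u := r) (v := t)
      by_cases hrt : r = t
      · subst hrt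
        simp only [SimpleGraph.dist_self, ne_eq, not_true_eq_false, false_and, and_false, false_or]
        omega
      · have := mt this.1 hrt
        simp only [hG, true_and, hrt, ne_eq, not_false_eq_true]
        constructor
        · rintro (h | h)
          · exact ⟨h.1, by omega⟩
          · exact ⟨h.1, by omega⟩
        · intro h
          by_cases h' : G.dist r t + 1 ≤ ⌊y⌋₊
          · exact .inl ⟨h.1, h'⟩
          · exact .inr ⟨h.1, by omega⟩
    · simp [hG]
  · refine Finset.disjoint_left.2 fun p hp hp' => ?_
    simp only [Finset.mem_filter, Finset.mem_univ, true_and,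
      ← Nat.le_floor_iff (zero_le_one.trans hy)] at hp hp'
    omega

/-- **Rayleigh limit law for the trunk height.**  For every `x > 0`, as `n → ∞` the
proportion of doubly rooted trees `(T, r, t)` on the vertex set `{1, …, n}` whose
trunk has at most `x √n` vertices (i.e. `dist T r t + 1 ≤ x √n`), among all
`(n - 1) * n^(n-1)` doubly rooted trees, converges to `1 - e^(-x²/2)`. -/
theorem trunk_height_rayleigh_limit (x : ℝ) (hx : 0 < x) :
    Filter.Tendsto (fun n : ℕ =>
      (Nat.card {p : SimpleGraph (Fin n) × Fin n × Fin n //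
          (p.1.Connected ∧ p.1.IsAcyclic) ∧ p.2.1 ≠ p.2.2 ∧
          ((p.1.dist p.2.1 p.2.2 + 1 : ℕ) : ℝ) ≤ x * Real.sqrt n} : ℝ) /
        (((n : ℝ) - 1) * (n : ℝ) ^ (n - 1)))
      Filter.atTop
      (nhds (1 - Real.exp (-x ^ 2 / 2))) := by
  have hs : Filter.Tendsto (fun n : ℕ => x * √(n : ℝ)) Filter.atTop Filter.atTop :=
    tendsto_sqrt_natCast.const_mul_atTop hx
  have hratio : Filter.Tendsto (fun n : ℕ => (n : ℝ) / ((n : ℝ) - 1)) Filter.atTop (nhds 1) := by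
    simpa [sub_eq_add_neg] using tendsto_natCast_div_add_atTop (-1 : ℝ)
  have hlim := (hratio.mul (tendsto_prod_one_sub_div hx)).const_sub 1
  rw [one_mul] at hlim
  refine hlim.congr' ?_
  filter_upwards [hs.eventually_ge_atTop 1, Filter.eventually_ge_atTop 2,
    eventually_floor_mul_sqrt_lt hx] with n hy hn hlt
  have hcard := card_short_trunk_add (by omega : 0 < n) hy
  rw [← @Nat.cast_inj ℝ] at hcard
  obtain ⟨m, rfl⟩ : ∃ m, n = m + 2 := ⟨n - 2, by omega⟩
  rw [Nat.cast_add, Nat.cast_mul, Nat.cast_mul, Nat.cast_descFactorial_eq_pow_mul_prod (by omega),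
    ← eq_sub_iff_add_eq, Nat.cast_pow, Nat.cast_pow, mul_right_comm, ← pow_add,
    Nat.add_sub_cancel' hlt] at hcard
  generalize (∏ i ∈ Finset.range (⌊x * √((m + 2 : ℕ) : ℝ)⌋₊ + 1),
    (1 - (i : ℝ) / ((m + 2 : ℕ) : ℝ))) = P at *
  have hm : (m : ℝ) + 2 - 1 ≠ 0 := by
    have := m.cast_nonneg (α := ℝ)
    exact ne_of_gt (by linarith)
  have hm' : (m : ℝ) + 2 ≠ 0 := by positivity
  rw [hcard, Nat.succ_descFactorial_succ, Nat.succ_descFactorial_succ, Nat.descFactorial_zero,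
    Nat.add_sub_cancel, show m + 2 - 1 = m + 1 by omega, pow_add _ m 2, pow_succ _ m]
  push_cast
  field_simp
  ring
end

section
/- For every ε > 0, as n → ∞ the proportion of doubly rooted trees (T, r, t) on the vertex set {1, …, n} whose trunk has more than n^{1/2+ε} vertices (i.e. dist_T(r, t) + 1 > n^{1/2+ε}), among all (n−1)·n^{n−1} doubly rooted trees, converges to 0. -/
/-- In a connected graph every vertex other than `r` has a neighbour one step closer to `r`. -/
theorem SimpleGraph.Connected.exists_parent {V : Type*} {G : SimpleGraph V} (hG : G.Connected)
    (r : V) : ∃ f : V → V, f r = r ∧ ∀ v, v ≠ r → G.Adj v (f v) ∧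
      G.dist (f v) r + 1 = G.dist v r := by
  classical
  have h : ∀ v, ∃ w, (v = r → w = r) ∧ (v ≠ r → G.Adj v w ∧ G.dist w r + 1 = G.dist v r) := by
    intro v
    by_cases hv : v = r
    · exact ⟨r, fun _ => rfl, fun h => absurd hv h⟩
    · obtain ⟨p, hp⟩ := hG.exists_walk_length_eq_dist v r
      cases p with
      | nil => exact absurd rfl hv
      | @cons _ w _ hadj q =>
        refine ⟨w, fun h => absurd h hv, fun _ => ⟨hadj, ?_⟩⟩
        have h1 := SimpleGraph.dist_le q
        have h2 := hG.dist_triangle (u := v) (v := w) (w := r)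
        rw [SimpleGraph.dist_eq_one_iff_adj.2 hadj] at h2
        rw [SimpleGraph.Walk.length_cons] at hp
        omega
  choose f hf using h
  exact ⟨f, (hf r).1 rfl, fun v hv => (hf v).2 hv⟩

theorem SimpleGraph.reachable_of_rank {V : Type*} {H : SimpleGraph V} {r : V} {f : V → V}
    (d : V → ℕ) (h : ∀ v, v ≠ r → H.Adj v (f v) ∧ d (f v) < d v) (v : V) : H.Reachable v r := by
  induction hd : d v using Nat.strong_induction_on generalizing v with
  | _ n ih =>
    by_cases hv : v = r
    · rw [hv]
    · exact (h v hv).1.reachable.trans (ih _ (hd ▸ (h v hv).2) _ rfl)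

/-- A tree is recovered from a parent function towards a root. -/
theorem SimpleGraph.IsTree.eq_fromRel_parent {V : Type*} {G : SimpleGraph V} (hG : G.IsTree)
    {r : V} {f : V → V} (hf : ∀ v, v ≠ r → G.Adj v (f v) ∧ G.dist (f v) r + 1 = G.dist v r)
    (hr : f r = r) : G = SimpleGraph.fromRel (fun v w => f v = w) := by
  have hle : SimpleGraph.fromRel (fun v w => f v = w) ≤ G := by
    intro v w h
    rw [SimpleGraph.fromRel_adj] at h
    obtain ⟨hne, h | h⟩ := h
    · subst h
      exact (hf v fun hv => hne (by rw [hv, hr])).1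
    · subst h
      exact (hf w fun hv => hne (by rw [hv, hr])).1.symm
  have hreach := SimpleGraph.reachable_of_rank (H := SimpleGraph.fromRel (fun v w => f v = w))
    (r := r) (f := f) (fun v => G.dist v r) fun v hv =>
      ⟨(SimpleGraph.fromRel_adj _ _ _).2 ⟨(hf v hv).1.ne, Or.inl rfl⟩, by have := (hf v hv).2; omega⟩
  have hconn : (SimpleGraph.fromRel (fun v w => f v = w)).Connected :=
    { preconnected := fun u v => (hreach u).trans (hreach v).symm
      nonempty := ⟨r⟩ }
  exact ((SimpleGraph.isTree_iff_minimal_connected.1 hG).eq_of_le hconn hle).symm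

theorem SimpleGraph.dist_iterate_parent {V : Type*} {G : SimpleGraph V}
    {r : V} {f : V → V} (hf : ∀ v, v ≠ r → G.Adj v (f v) ∧ G.dist (f v) r + 1 = G.dist v r)
    (hr : f r = r) (t : V) (i : ℕ) : G.dist (f^[i] t) r = G.dist t r - i := by
  induction i with
  | zero => simp
  | succ i ih =>
    rw [Function.iterate_succ_apply']
    by_cases h : f^[i] t = r
    · rw [h, SimpleGraph.dist_self] at ih
      rw [h, hr, SimpleGraph.dist_self]
      omega
    · have := (hf _ h).2
      omega

/-- The pairs of a self-map and a starting point whose first `k + 1` iterates are distinct. -/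
def injectiveOrbits (V : Type*) (k : ℕ) : Set ((V → V) × V) :=
  {q | Function.Injective fun i : Fin (k + 1) => q.1^[i] q.2}

/-- Doubly rooted trees whose root and top are at distance at least `k` are encoded injectively by
their parent function together with the top. -/
theorem card_long_trunk_le (n k : ℕ) (P : SimpleGraph (Fin n) × Fin n × Fin n → Prop)
    (hP : ∀ p, P p → p.1.IsTree ∧ k ≤ p.1.dist p.2.1 p.2.2) :
    Nat.card {p // P p} ≤ Nat.card (injectiveOrbits (Fin n) k) := by
  choose f hr hf using fun p : {p // P p} => (hP p.1 p.2).1.connected.exists_parent p.1.2.1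
  have hinj : ∀ p : {p // P p}, (f p, p.1.2.2) ∈ injectiveOrbits (Fin n) k := by
    intro p i j hij
    have hi := SimpleGraph.dist_iterate_parent (hf p) (hr p) p.1.2.2 i
    have hj := SimpleGraph.dist_iterate_parent (hf p) (hr p) p.1.2.2 j
    have hk := (hP p.1 p.2).2
    rw [SimpleGraph.dist_comm] at hk
    dsimp only at hij
    rw [hij, hj] at hi
    ext
    omega
  refine Nat.card_le_card_of_injective (fun p => ⟨(f p, p.1.2.2), hinj p⟩) ?_
  intro p q hpq
  simp only [Subtype.mk.injEq, Prod.mk.injEq] at hpq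
  have hG : p.1.1 = q.1.1 := by
    rw [(hP p.1 p.2).1.eq_fromRel_parent (hf p) (hr p),
      (hP q.1 q.2).1.eq_fromRel_parent (hf q) (hr q), hpq.1]
  have hroot : p.1.2.1 = q.1.2.1 := by
    by_contra h
    have h1 := (hf q _ h).1.ne
    rw [← hpq.1, hr p] at h1
    exact h1 rfl
  exact Subtype.ext (Prod.ext hG (Prod.ext hroot hpq.2))

/-- A pair in `injectiveOrbits` is determined by its first `k + 1` iterates and the values of the
map off the first `k` of them. -/
theorem card_injectiveOrbits_le (n k : ℕ) :
    Nat.card (injectiveOrbits (Fin n) k) ≤ n.descFactorial (k + 1) * n ^ (n - k) := by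
  classical
  let S := Σ s : Fin (k + 1) ↪ Fin n, ({v : Fin n // ∀ i : Fin k, s i.castSucc ≠ v} → Fin n)
  have hS : Nat.card S = n.descFactorial (k + 1) * n ^ (n - k) := by
    have hc (s : Fin (k + 1) ↪ Fin n) :
        Fintype.card {v : Fin n // ∀ i : Fin k, s i.castSucc ≠ v} = n - k := by
      have h : (Finset.univ.map (Fin.castSuccEmb.trans s))ᶜ =
          Finset.univ.filter fun v => ∀ i : Fin k, s i.castSucc ≠ v := by
        ext v
        simp
      rw [Fintype.card_subtype, ← h, Finset.card_compl]
      simp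
    rw [Nat.card_eq_fintype_card, Fintype.card_sigma]
    simp only [Fintype.card_fun, hc]
    simp
  rw [← hS]
  refine Nat.card_le_card_of_injective
    (fun q : injectiveOrbits (Fin n) k => (⟨⟨_, q.2⟩, fun v => q.1.1 v⟩ : S)) ?_
  rintro ⟨⟨f, t⟩, hf⟩ ⟨⟨g, u⟩, hg⟩ h
  have horb : ∀ i : Fin (k + 1), f^[i] t = g^[i] u := fun i =>
    congrArg (fun s : S => s.1 i) h
  have ht : t = u := horb 0
  have hval : ∀ v : Fin n, (∀ i : Fin k, f^[i.castSucc] t ≠ v) → f v = g v := by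
    intro v hv
    have := congrArg (fun s : S => if h : ∀ i : Fin k, s.1 i.castSucc ≠ v then s.2 ⟨v, h⟩ else v) h
    have hv' : ∀ i : Fin k, g^[i.castSucc] u ≠ v := fun i => by rw [← horb]; exact hv i
    exact (dif_pos hv).symm.trans (this.trans (dif_pos hv'))
  have hfg : f = g := by
    ext1 v
    by_cases hv : ∀ i : Fin k, f^[i.castSucc] t ≠ v
    · exact hval v hv
    · push Not at hv
      obtain ⟨i, rfl⟩ := hv
      have := horb i.succ
      rw [Fin.val_succ, Function.iterate_succ_apply', Function.iterate_succ_apply'] at this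
      have h2 := horb i.castSucc
      rw [Fin.val_castSucc] at h2 ⊢
      rw [this, h2]
  subst ht hfg
  rfl

theorem Nat.descFactorial_le_pow_mul_exp {n : ℕ} (hn : 0 < n) (k : ℕ) :
    (n.descFactorial k : ℝ) ≤ (n : ℝ) ^ k * Real.exp (-(k * (k - 1) / (2 * n))) := by
  have hn' : (0 : ℝ) < n := Nat.cast_pos.2 hn
  induction k with
  | zero => simp
  | succ k ih =>
    have h1 : ((n - k : ℕ) : ℝ) ≤ n * Real.exp (-(k / n)) := by
      rcases le_total n k with h | h
      · rw [Nat.sub_eq_zero_of_le h, Nat.cast_zero]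
        positivity
      · rw [Nat.cast_sub h]
        calc (n : ℝ) - k = n * (1 - k / n) := by field_simp
          _ ≤ _ := by gcongr; exact Real.one_sub_le_exp_neg _
    rw [Nat.descFactorial_succ, Nat.cast_mul]
    calc ((n - k : ℕ) : ℝ) * (n.descFactorial k : ℝ)
        ≤ (n * Real.exp (-(k / n))) * ((n : ℝ) ^ k * Real.exp (-(k * (k - 1) / (2 * n)))) := by
          gcongr
      _ = (n : ℝ) ^ (k + 1) * (Real.exp (-(k / n)) * Real.exp (-(k * (k - 1) / (2 * n)))) := by ring
      _ = _ := by
        rw [← Real.exp_add]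
        congr 2
        push_cast
        field_simp
        ring

theorem card_injectiveOrbits_div_le {n : ℕ} (hn : 2 ≤ n) (k : ℕ) :
    (Nat.card (injectiveOrbits (Fin n) k) : ℝ) / (((n : ℝ) - 1) * (n : ℝ) ^ (n - 1)) ≤
      2 * n * Real.exp (-((k : ℝ) ^ 2 / (2 * n))) := by
  have hn' : (2 : ℝ) ≤ n := by exact_mod_cast hn
  have hpos : 0 < ((n : ℝ) - 1) * (n : ℝ) ^ (n - 1) := by
    have : (0 : ℝ) < n - 1 := by linarith
    positivity
  rw [div_le_iff₀ hpos]
  rcases lt_or_ge n (k + 1) with hk | hk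
  · have h := card_injectiveOrbits_le n k
    rw [Nat.descFactorial_of_lt hk, zero_mul, Nat.le_zero] at h
    rw [h, Nat.cast_zero]
    positivity
  · have hexp : Real.exp (-(((k + 1 : ℕ) : ℝ) * (((k + 1 : ℕ) : ℝ) - 1) / (2 * n))) ≤
        Real.exp (-((k : ℝ) ^ 2 / (2 * n))) := by
      gcongr
      push_cast
      nlinarith [(Nat.cast_nonneg k : (0 : ℝ) ≤ k)]
    have hpow : (n : ℝ) ^ (k + 1) * (n : ℝ) ^ (n - k) = n * n * (n : ℝ) ^ (n - 1) := by
      rw [← pow_add, mul_assoc, ← pow_succ', ← pow_succ']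
      congr 1
      omega
    calc (Nat.card (injectiveOrbits (Fin n) k) : ℝ)
        ≤ (n.descFactorial (k + 1) : ℝ) * (n : ℝ) ^ (n - k) := by
          exact_mod_cast card_injectiveOrbits_le n k
      _ ≤ ((n : ℝ) ^ (k + 1) * Real.exp (-((k : ℝ) ^ 2 / (2 * n)))) * (n : ℝ) ^ (n - k) := by
          gcongr
          exact (Nat.descFactorial_le_pow_mul_exp (by omega) _).trans (by gcongr)
      _ = n * Real.exp (-((k : ℝ) ^ 2 / (2 * n))) * n * (n : ℝ) ^ (n - 1) := by
          rw [mul_right_comm, hpow]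
          ring
      _ ≤ n * Real.exp (-((k : ℝ) ^ 2 / (2 * n))) * (2 * (n - 1)) * (n : ℝ) ^ (n - 1) := by
          gcongr
          linarith
      _ = _ := by ring

/-- The tail bound at `k = ⌊n^(1/2 + ε)⌋` tends to zero. -/
theorem tendsto_mul_exp_neg_floor_rpow_sq (ε : ℝ) (hε : 0 < ε) :
    Filter.Tendsto (fun n : ℕ => 2 * (n : ℝ) *
      Real.exp (-((⌊(n : ℝ) ^ ((1 : ℝ) / 2 + ε)⌋₊ : ℝ) ^ 2 / (2 * n)))) Filter.atTop (nhds 0) := by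
  have hlim : Filter.Tendsto
      (fun n : ℕ => 2 * ((n : ℝ) * Real.exp (-(1 / 8) * (n : ℝ) ^ (2 * ε))))
      Filter.atTop (nhds 0) := by
    have h1 : Filter.Tendsto (fun n : ℕ => (n : ℝ) ^ (2 * ε)) Filter.atTop Filter.atTop :=
      (tendsto_rpow_atTop (by positivity)).comp tendsto_natCast_atTop_atTop
    have h2 := ((tendsto_rpow_mul_exp_neg_mul_atTop_nhds_zero (1 / (2 * ε)) (1 / 8)
      (by norm_num)).comp h1).const_mul 2
    rw [mul_zero] at h2
    refine h2.congr fun n => ?_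
    simp only [Function.comp_apply]
    rw [← Real.rpow_mul (Nat.cast_nonneg n), mul_one_div_cancel (by positivity), Real.rpow_one]
  refine squeeze_zero' (Filter.Eventually.of_forall fun n => by positivity) ?_ hlim
  filter_upwards [Filter.eventually_ge_atTop 1] with n hn
  have hn1 : (1 : ℝ) ≤ n := by exact_mod_cast hn
  have hn0 : (0 : ℝ) < n := by linarith
  set x := (n : ℝ) ^ ((1 : ℝ) / 2 + ε) with hx
  have hx1 : 1 ≤ x := Real.one_le_rpow hn1 (by positivity)
  have hfl : x / 2 ≤ (⌊x⌋₊ : ℝ) := by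
    have h1 := Nat.lt_floor_add_one x
    have h2 : (1 : ℝ) ≤ (⌊x⌋₊ : ℝ) := by exact_mod_cast (Nat.one_le_floor_iff x).2 hx1
    linarith
  have hsq : x ^ 2 = n * (n : ℝ) ^ (2 * ε) := by
    rw [hx, ← Real.rpow_natCast, ← Real.rpow_mul hn0.le,
      show ((1 : ℝ) / 2 + ε) * ((2 : ℕ) : ℝ) = 1 + 2 * ε by push_cast; ring,
      Real.rpow_add hn0, Real.rpow_one]
  rw [mul_assoc]
  gcongr
  rw [neg_mul, neg_le_neg_iff, le_div_iff₀ (by positivity)]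
  nlinarith

/-- For every `ε > 0`, as `n → ∞` the proportion of doubly rooted trees `(T, r, t)`
on the vertex set `{1, …, n}` whose trunk has more than `n^(1/2 + ε)` vertices
(i.e. `dist T r t + 1 > n^(1/2 + ε)`), among all `(n - 1) * n^(n-1)` doubly rooted
trees, converges to `0`. -/
theorem trunk_height_large_deviation (ε : ℝ) (hε : 0 < ε) :
    Filter.Tendsto (fun n : ℕ =>
      (Nat.card {p : SimpleGraph (Fin n) × Fin n × Fin n //
          (p.1.Connected ∧ p.1.IsAcyclic) ∧ p.2.1 ≠ p.2.2 ∧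
          ((p.1.dist p.2.1 p.2.2 + 1 : ℕ) : ℝ) > (n : ℝ) ^ ((1 : ℝ) / 2 + ε)} : ℝ) /
        (((n : ℝ) - 1) * (n : ℝ) ^ (n - 1)))
      Filter.atTop
      (nhds 0) := by
  refine squeeze_zero' ?_ ?_ (tendsto_mul_exp_neg_floor_rpow_sq ε hε)
  all_goals
    filter_upwards [Filter.eventually_ge_atTop 2] with n hn
    have hn' : (0 : ℝ) < n - 1 := by
      have : (2 : ℝ) ≤ n := by exact_mod_cast hn
      linarith
  · positivity
  · refine le_trans ?_ (card_injectiveOrbits_div_le hn _)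
    gcongr
    refine card_long_trunk_le n _ _ fun p hp => ⟨⟨hp.1.1, hp.1.2⟩, ?_⟩
    have h := (Nat.floor_lt (by positivity)).2 hp.2.2
    omega
end
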